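/- arXiv:2502.08318 — 3 statements merged into one kernel-verified Lean document; each statement's English description precedes it below -/
import Mathlib

section
/- Let m be a positive integer and B_1 the open unit ball in ℝ^{2m}. Suppose f ∈ L¹_loc(B_1) and v is a distributional solution of (−Δ)^m v = f in B_1. Then for every p > 1 and every r ∈ (0,1), ∫_{B_r} e^{p|v(x)|} dx < ∞; that is, e^{p|v|} ∈ L¹_loc(B_1) for all p > 1. -/
open MeasureTheory Metric Real Set
open scoped ENNReal NNReal

noncomputable section

/-- First-order partial derivative in direction `i`. -/
def pderiv1 {n : ℕ} (i : Fin n) (f : EuclideanSpace ℝ (Fin n) → ℝ) :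
    EuclideanSpace ℝ (Fin n) → ℝ :=
  fun x => fderiv ℝ f x (EuclideanSpace.single i 1)

/-- The Laplacian `Δf = ∑ ∂²f/∂xᵢ²`. -/
def lap {n : ℕ} (f : EuclideanSpace ℝ (Fin n) → ℝ) : EuclideanSpace ℝ (Fin n) → ℝ :=
  fun x => ∑ i, pderiv1 i (pderiv1 i f) x

/-- The negative Laplacian `-Δ`. -/
def nlap {n : ℕ} (f : EuclideanSpace ℝ (Fin n) → ℝ) : EuclideanSpace ℝ (Fin n) → ℝ :=
  fun x => -(lap f x)

/-- `(-Δ)^m`, the m-th iterate of the negative Laplacian. -/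
def nlapIter {n : ℕ} (m : ℕ) (f : EuclideanSpace ℝ (Fin n) → ℝ) :
    EuclideanSpace ℝ (Fin n) → ℝ :=
  nlap^[m] f

/-- `D^β`, the mixed partial derivative associated to a multi-index `β`. -/
def mderiv {n : ℕ} (β : Fin n → ℕ) (f : EuclideanSpace ℝ (Fin n) → ℝ) :
    EuclideanSpace ℝ (Fin n) → ℝ :=
  ((List.finRange n).foldr (fun i F => F ∘ (pderiv1 i)^[β i]) id) f

/-- The finset of multi-indices `β` with `|β| ≤ s`. -/
def degLE (n s : ℕ) : Finset (Fin n → ℕ) :=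
  (Fintype.piFinset fun _ : Fin n => Finset.range (s+1)).filter fun β => ∑ i, β i ≤ s

/-- The finset of multi-indices `β` with `|β| < s` (i.e. `|β| ≤ s - 1`; empty for `s = 0`). -/
def degLT (n s : ℕ) : Finset (Fin n → ℕ) :=
  (Fintype.piFinset fun _ : Fin n => Finset.range s).filter fun β => ∑ i, β i < s

/-- Fundamental-solution profile of `(-Δ)^m` on `ℝⁿ`:
`c‖x‖^{2m-n}` for `n > 2m` and `c ln(5/‖x‖)` for `n = 2m`. -/
def fundSol (m n : ℕ) (c : ℝ) : EuclideanSpace ℝ (Fin n) → ℝ :=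
  fun x => if n = 2*m then c * Real.log (5 / ‖x‖) else c * ‖x‖ ^ ((2*m : ℤ) - n)

/-- `ψ(x,y) = φ(x-y) - ∑_{|β| ≤ s-1} ((-y)^β/β!) D^β φ(x)`. -/
def psiFun (m n s : ℕ) (c : ℝ) (x y : EuclideanSpace ℝ (Fin n)) : ℝ :=
  fundSol m n c (x - y) -
    ∑ β ∈ degLT n s,
      ((∏ i, (-(y i)) ^ β i) / ∏ i, ((β i).factorial : ℝ)) * mderiv β (fundSol m n c) x

/-- `N(x) = ∫_{|y| ≤ 1} ψ(x,y) f(y) dy`. -/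
def NFun (m n s : ℕ) (c : ℝ) (f : EuclideanSpace ℝ (Fin n) → ℝ)
    (x : EuclideanSpace ℝ (Fin n)) : ℝ :=
  ∫ y in closedBall (0 : EuclideanSpace ℝ (Fin n)) 1, psiFun m n s c x y * f y

section Differentiation

open Filter Topology

variable {n : ℕ}

lemma Filter.EventuallyEq.pderiv1 {g h : EuclideanSpace ℝ (Fin n) → ℝ}
    {z : EuclideanSpace ℝ (Fin n)} (i : Fin n) (H : g =ᶠ[𝓝 z] h) :
    pderiv1 i g =ᶠ[𝓝 z] pderiv1 i h := by
  filter_upwards [H.fderiv (𝕜 := ℝ)] with y hy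
  simp only [_root_.pderiv1, hy]

lemma Filter.EventuallyEq.nlap {g h : EuclideanSpace ℝ (Fin n) → ℝ}
    {z : EuclideanSpace ℝ (Fin n)} (H : g =ᶠ[𝓝 z] h) : nlap g =ᶠ[𝓝 z] nlap h := by
  have h2 : ∀ᶠ y in 𝓝 z, ∀ i, _root_.pderiv1 i (_root_.pderiv1 i g) y =
      _root_.pderiv1 i (_root_.pderiv1 i h) y :=
    eventually_all.2 fun i => (H.pderiv1 i).pderiv1 i
  filter_upwards [h2] with y hy
  simp only [_root_.nlap, lap, hy]

lemma nlapIter_succ (k : ℕ) (g : EuclideanSpace ℝ (Fin n) → ℝ) :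
    nlapIter (k + 1) g = nlap (nlapIter k g) :=
  Function.iterate_succ_apply' _ _ _

lemma Filter.EventuallyEq.nlapIter {g h : EuclideanSpace ℝ (Fin n) → ℝ}
    {z : EuclideanSpace ℝ (Fin n)} (k : ℕ) (H : g =ᶠ[𝓝 z] h) :
    nlapIter k g =ᶠ[𝓝 z] nlapIter k h := by
  induction k with
  | zero => exact H
  | succ k ih => simpa only [nlapIter_succ] using ih.nlap

lemma nlapIter_zero_fun (k : ℕ) :
    nlapIter k (fun _ : EuclideanSpace ℝ (Fin n) => (0 : ℝ)) = fun _ => 0 := by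
  induction k with
  | zero => rfl
  | succ k ih =>
    rw [nlapIter_succ, ih]
    have h (i : Fin n) : pderiv1 i (fun _ : EuclideanSpace ℝ (Fin n) => (0 : ℝ)) = fun _ => 0 := by
      ext x
      simp [pderiv1]
    ext x
    simp [nlap, lap, h]

lemma pderiv1_comp_sub (i : Fin n) (g : EuclideanSpace ℝ (Fin n) → ℝ)
    (x : EuclideanSpace ℝ (Fin n)) :
    pderiv1 i (fun y => g (y - x)) = fun y => pderiv1 i g (y - x) := by
  ext y
  simp only [pderiv1, sub_eq_add_neg, fderiv_comp_add_right]

lemma nlapIter_comp_sub (k : ℕ) (g : EuclideanSpace ℝ (Fin n) → ℝ)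
    (x : EuclideanSpace ℝ (Fin n)) :
    nlapIter k (fun y => g (y - x)) = fun y => nlapIter k g (y - x) := by
  induction k with
  | zero => rfl
  | succ k ih =>
    rw [nlapIter_succ, ih, nlapIter_succ]
    ext y
    simp only [nlap, lap, pderiv1_comp_sub]

lemma hasFDerivAt_comp_norm_sq_add {φ : ℝ → ℝ} {φ' a : ℝ} {x : EuclideanSpace ℝ (Fin n)}
    (h : HasDerivAt φ φ' (‖x‖ ^ 2 + a)) :
    HasFDerivAt (fun y : EuclideanSpace ℝ (Fin n) => φ (‖y‖ ^ 2 + a))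
      (φ' • (2 • innerSL ℝ x)) x :=
  h.comp_hasFDerivAt x ((hasStrictFDerivAt_norm_sq x).hasFDerivAt.add_const a)

lemma pderiv1_comp_norm_sq_add {φ φ₁ : ℝ → ℝ} {a : ℝ} (ha : 0 < a)
    (h₁ : ∀ t, 0 < t → HasDerivAt φ (φ₁ t) t) (i : Fin n) :
    pderiv1 i (fun y : EuclideanSpace ℝ (Fin n) => φ (‖y‖ ^ 2 + a)) =
      fun y => 2 * y i * φ₁ (‖y‖ ^ 2 + a) := by
  ext x
  rw [pderiv1, (hasFDerivAt_comp_norm_sq_add (h₁ _ (by positivity))).fderiv]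
  simp [EuclideanSpace.inner_single_right]
  ring

/-- The Laplacian of a radial function, written in the variable `t = ‖x‖² + a`. -/
lemma nlap_comp_norm_sq_add {φ φ₁ φ₂ : ℝ → ℝ} {a : ℝ} (ha : 0 < a)
    (h₁ : ∀ t, 0 < t → HasDerivAt φ (φ₁ t) t) (h₂ : ∀ t, 0 < t → HasDerivAt φ₁ (φ₂ t) t) :
    nlap (fun y : EuclideanSpace ℝ (Fin n) => φ (‖y‖ ^ 2 + a)) =
      fun y => -(4 * ‖y‖ ^ 2 * φ₂ (‖y‖ ^ 2 + a) + 2 * n * φ₁ (‖y‖ ^ 2 + a)) := by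
  ext x
  have key : ∀ i, pderiv1 i (pderiv1 i
      (fun y : EuclideanSpace ℝ (Fin n) => φ (‖y‖ ^ 2 + a))) x =
      4 * φ₂ (‖x‖ ^ 2 + a) * x i ^ 2 + 2 * φ₁ (‖x‖ ^ 2 + a) := by
    intro i
    rw [pderiv1_comp_norm_sq_add ha h₁, pderiv1]
    have hp : HasFDerivAt (fun y : EuclideanSpace ℝ (Fin n) => 2 * y i)
        ((2 : ℝ) • EuclideanSpace.proj (𝕜 := ℝ) i) x :=
      (EuclideanSpace.proj (𝕜 := ℝ) i).hasFDerivAt.const_mul 2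
    rw [(hp.fun_mul (hasFDerivAt_comp_norm_sq_add (h₂ _ (by positivity)))).fderiv]
    simp [EuclideanSpace.inner_single_right]
    ring
  simp only [nlap, lap, key, Finset.sum_add_distrib, ← Finset.mul_sum, Finset.sum_const,
    Finset.card_univ, Fintype.card_fin, nsmul_eq_mul, ← EuclideanSpace.real_norm_sq_eq]
  ring

end Differentiation

section LogKernel

/-- The coefficient of `aⁱ (‖x‖² + a)^{-(l+1+i)}` in `(-Δ)^{l+1} (-log (‖x‖² + a))` on `ℝ^{2m}`. -/
def logKernelCoeff (m l i : ℕ) : ℝ :=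
  4 ^ (l + 1) * (l + 1).choose i * (l + i).factorial *
    ∏ t ∈ Finset.Ico (i + 1) (l + 2), ((m : ℝ) - t)

lemma logKernelCoeff_eq_zero_of_lt {m l i : ℕ} (h : l + 1 < i) : logKernelCoeff m l i = 0 := by
  simp [logKernelCoeff, Nat.choose_eq_zero_of_lt h]

lemma logKernelCoeff_succ_zero (m l : ℕ) :
    logKernelCoeff m (l + 1) 0 = 4 * ((l + 1) * (m - l - 2)) * logKernelCoeff m l 0 := by
  simp only [logKernelCoeff, Finset.prod_Ico_succ_top (show 0 + 1 ≤ l + 2 by omega),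
    Nat.choose_zero_right, add_zero, Nat.factorial_succ]
  push_cast
  ring

lemma logKernelCoeff_succ_succ (m l i : ℕ) :
    logKernelCoeff m (l + 1) (i + 1) =
      4 * ((l + 1 + (i + 1)) * (m - (l + 1) - (i + 1) - 1)) * logKernelCoeff m l (i + 1) +
        4 * ((l + 1 + i) * (l + 1 + i + 1)) * logKernelCoeff m l i := by
  rcases lt_trichotomy i (l + 1) with h | rfl | h
  · have hc : ((l + 1).choose (i + 1) : ℝ) * (i + 1) = (l + 1).choose i * (l + 1 - i) := by
      have := Nat.choose_succ_right_eq (l + 1) i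
      have h' : ((l + 1 - i : ℕ) : ℝ) = l + 1 - i := by
        rw [Nat.cast_sub h.le]; push_cast; ring
      rw [← h']
      exact_mod_cast this
    simp only [logKernelCoeff]
    rw [Finset.prod_Ico_succ_top (show i + 1 + 1 ≤ l + 2 by omega),
      Finset.prod_eq_prod_Ico_succ_bot (show i + 1 < l + 2 by omega),
      Nat.choose_succ_succ (l + 1) i, show l + 1 + (i + 1) = l + i + 1 + 1 by ring,
      show l + (i + 1) = l + i + 1 by ring, Nat.factorial_succ (l + i + 1),
      Nat.factorial_succ (l + i)]
    push_cast
    generalize (∏ t ∈ Finset.Ico (i + 1 + 1) (l + 2), ((m : ℝ) - t)) = P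
    generalize ((l + 1).choose (i + 1) : ℝ) = c₁ at *
    generalize ((l + 1).choose i : ℝ) = c₀ at *
    linear_combination (4 ^ (l + 1 + 1) * (l + i + 1 + 1) * (l + i + 1) * (l + i).factorial * P) * hc
  · rw [logKernelCoeff_eq_zero_of_lt (show l + 1 < l + 1 + 1 by omega)]
    simp only [logKernelCoeff, Finset.Ico_self, Finset.prod_empty, Nat.choose_self]
    rw [show l + 1 + (l + 1 + 1) = l + (l + 1) + 1 + 1 by ring, Nat.factorial_succ,
      Nat.factorial_succ]
    push_cast
    ring
  · rw [logKernelCoeff_eq_zero_of_lt h, logKernelCoeff_eq_zero_of_lt (by omega),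
      logKernelCoeff_eq_zero_of_lt (by omega)]
    ring

lemma hasDerivAt_inv_pow (k : ℕ) {t : ℝ} (ht : 0 < t) :
    HasDerivAt (fun s : ℝ => s⁻¹ ^ k) (-(k * t⁻¹ ^ (k + 1))) t := by
  refine ((hasDerivAt_inv ht.ne').fun_pow k).congr_deriv ?_
  rcases k with _ | k
  · simp
  · simp only [Nat.add_sub_cancel, inv_pow]
    field_simp
    ring

lemma nlapIter_neg_log_aux (m : ℕ) {a : ℝ} (ha : 0 < a) (l : ℕ) :
    nlapIter (l + 1) (fun y : EuclideanSpace ℝ (Fin (2 * m)) => -Real.log (‖y‖ ^ 2 + a)) =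
      fun y => ∑ i ∈ Finset.range (l + 2),
        logKernelCoeff m l i * a ^ i * (‖y‖ ^ 2 + a)⁻¹ ^ (l + 1 + i) := by
  induction l with
  | zero =>
    have h₁ : ∀ t : ℝ, 0 < t → HasDerivAt (fun s => -Real.log s) (-(t⁻¹ ^ 1)) t := by
      intro t ht
      simpa using (Real.hasDerivAt_log ht.ne').fun_neg
    have h₂ : ∀ t : ℝ, 0 < t → HasDerivAt (fun s : ℝ => -(s⁻¹ ^ 1)) (t⁻¹ ^ 2) t := by
      intro t ht
      simpa using (hasDerivAt_inv_pow 1 ht).fun_neg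
    rw [nlapIter_succ]
    rw [show nlapIter 0 (fun y : EuclideanSpace ℝ (Fin (2 * m)) => -Real.log (‖y‖ ^ 2 + a)) =
      fun y => -Real.log (‖y‖ ^ 2 + a) from rfl, nlap_comp_norm_sq_add ha h₁ h₂]
    ext y
    have hs : ‖y‖ ^ 2 + a ≠ 0 := by positivity
    simp [Finset.sum_range_succ, logKernelCoeff]
    field_simp
    ring
  | succ l ih =>
    have h₁ : ∀ t : ℝ, 0 < t → HasDerivAt
        (fun s => ∑ i ∈ Finset.range (l + 2),
          logKernelCoeff m l i * a ^ i * s⁻¹ ^ (l + 1 + i))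
        (∑ i ∈ Finset.range (l + 2), logKernelCoeff m l i * a ^ i *
          (-((l + 1 + i : ℕ) * t⁻¹ ^ (l + 1 + i + 1)))) t := fun t ht =>
      HasDerivAt.fun_sum fun i _ => (hasDerivAt_inv_pow _ ht).const_mul _
    have h₂ : ∀ t : ℝ, 0 < t → HasDerivAt
        (fun s => ∑ i ∈ Finset.range (l + 2), logKernelCoeff m l i * a ^ i *
          (-((l + 1 + i : ℕ) * s⁻¹ ^ (l + 1 + i + 1))))
        (∑ i ∈ Finset.range (l + 2), logKernelCoeff m l i * a ^ i *
          (-((l + 1 + i : ℕ) * -((l + 1 + i + 1 : ℕ) * t⁻¹ ^ (l + 1 + i + 1 + 1))))) t :=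
      fun t ht => HasDerivAt.fun_sum fun i _ =>
        (((hasDerivAt_inv_pow _ ht).const_mul _).fun_neg).const_mul _
    rw [nlapIter_succ, ih, nlap_comp_norm_sq_add ha h₁ h₂]
    ext y
    have hs : ‖y‖ ^ 2 + a ≠ 0 := by positivity
    set s := ‖y‖ ^ 2 + a with hsdef
    have hy : ‖y‖ ^ 2 = s - a := by rw [hsdef]; ring
    rw [hy]
    set A : ℕ → ℝ := fun i =>
      4 * ((l + 1 + i) * (m - (l + 1) - i - 1)) * logKernelCoeff m l i
    set B : ℕ → ℝ := fun i => 4 * ((l + 1 + i) * (l + 1 + i + 1)) * logKernelCoeff m l i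
    have hA : A (l + 2) = 0 := by
      simp only [A, logKernelCoeff_eq_zero_of_lt (show l + 1 < l + 2 by omega), mul_zero]
    have hsum : ∑ i ∈ Finset.range (l + 3),
        logKernelCoeff m (l + 1) i * a ^ i * s⁻¹ ^ (l + 1 + 1 + i) =
        ∑ i ∈ Finset.range (l + 2), A i * a ^ i * s⁻¹ ^ (l + 1 + 1 + i) +
        ∑ i ∈ Finset.range (l + 2), B i * a ^ (i + 1) * s⁻¹ ^ (l + 1 + 1 + (i + 1)) := by
      have : ∑ i ∈ Finset.range (l + 2), A i * a ^ i * s⁻¹ ^ (l + 1 + 1 + i) =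
          ∑ i ∈ Finset.range (l + 3), A i * a ^ i * s⁻¹ ^ (l + 1 + 1 + i) := by
        rw [Finset.sum_range_succ _ (l + 2), hA]; ring
      rw [this, Finset.sum_range_succ', Finset.sum_range_succ' _ (l + 2), add_right_comm (Finset.sum _ _),
        logKernelCoeff_succ_zero]
      have hd := Finset.sum_add_distrib (s := Finset.range (l + 2))
        (f := fun i => A (i + 1) * a ^ (i + 1) * s⁻¹ ^ (l + 1 + 1 + (i + 1)))
        (g := fun i => B i * a ^ (i + 1) * s⁻¹ ^ (l + 1 + 1 + (i + 1)))
      rw [← hd]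
      congr 1
      · refine Finset.sum_congr rfl fun i _ => ?_
        rw [logKernelCoeff_succ_succ]
        simp only [A, B]
        push_cast
        ring
      · simp only [A]
        push_cast
        ring
    rw [show l + 1 + 2 = l + 3 by ring, hsum, ← Finset.sum_add_distrib, Finset.mul_sum,
      Finset.mul_sum, ← Finset.sum_add_distrib, ← Finset.sum_neg_distrib]
    refine Finset.sum_congr rfl fun i _ => ?_
    have e₁ : s⁻¹ ^ (l + 1 + i + 1) = s * s⁻¹ ^ (l + 1 + i + 2) := by
      rw [pow_succ _ (l + 1 + i + 1)]; field_simp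
    rw [show l + 1 + 1 + i = l + 1 + i + 1 by ring, show l + 1 + 1 + (i + 1) = l + 1 + i + 2 by ring,
      show l + 1 + i + 1 + 1 = l + 1 + i + 2 by ring, e₁]
    simp only [A, B]
    push_cast
    ring

/-- On `ℝ^{2m}`, `(-Δ)^m` maps the regularised logarithm to a multiple of a concentrating
bubble. -/
lemma nlapIter_neg_log {m : ℕ} (hm : 0 < m) {a : ℝ} (ha : 0 < a) :
    nlapIter m (fun y : EuclideanSpace ℝ (Fin (2 * m)) => -Real.log (‖y‖ ^ 2 + a)) =
      fun y => 4 ^ m * (2 * m - 1).factorial * (a ^ m * (‖y‖ ^ 2 + a)⁻¹ ^ (2 * m)) := by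
  obtain ⟨l, rfl⟩ : ∃ l, m = l + 1 := ⟨m - 1, by omega⟩
  rw [nlapIter_neg_log_aux (l + 1) ha l]
  ext y
  rw [Finset.sum_range_succ, Finset.sum_eq_zero, zero_add]
  · simp only [logKernelCoeff, Nat.choose_self, Finset.Ico_self, Finset.prod_empty]
    rw [show 2 * (l + 1) - 1 = l + (l + 1) by omega, show l + 1 + (l + 1) = 2 * (l + 1) by ring]
    push_cast
    ring
  · intro i hi
    have : ∏ t ∈ Finset.Ico (i + 1) (l + 2), (((l + 1 : ℕ) : ℝ) - t) = 0 :=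
      Finset.prod_eq_zero (i := l + 1) (by simp at hi ⊢; omega) (by simp)
    rw [logKernelCoeff, this]
    ring

end LogKernel

section ParametricSmoothness

open Filter Topology

variable {n : ℕ} {O : Set (EuclideanSpace ℝ (Fin n) × ℝ)} {F : EuclideanSpace ℝ (Fin n) × ℝ → ℝ}

lemma exists_contDiffOn_pderiv1 (hO : IsOpen O) (hF : ContDiffOn ℝ (⊤ : ℕ∞) F O) (i : Fin n) :
    ∃ F' : EuclideanSpace ℝ (Fin n) × ℝ → ℝ, ContDiffOn ℝ (⊤ : ℕ∞) F' O ∧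
      ∀ p ∈ O, pderiv1 i (fun y => F (y, p.2)) p.1 = F' p := by
  refine ⟨fun p => fderiv ℝ F p (EuclideanSpace.single i 1, 0),
    (hF.fderiv_of_isOpen hO (by simp)).clm_apply contDiffOn_const, fun p hp => ?_⟩
  have h₁ : HasFDerivAt F (fderiv ℝ F p) (p.1, p.2) :=
    ((hF.contDiffAt (hO.mem_nhds hp)).differentiableAt (by simp)).hasFDerivAt
  have h₂ : HasFDerivAt (F ∘ fun y => (y, p.2))
      ((fderiv ℝ F p).comp (ContinuousLinearMap.inl ℝ _ ℝ)) p.1 :=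
    HasFDerivAt.comp p.1 (f := fun y => (y, p.2)) h₁ (hasFDerivAt_prodMk_left p.1 p.2)
  rw [pderiv1, show (fun y => F (y, p.2)) = F ∘ fun y => (y, p.2) from rfl, h₂.fderiv]
  simp

lemma eventually_slice_mem (hO : IsOpen O) {p : EuclideanSpace ℝ (Fin n) × ℝ} (hp : p ∈ O) :
    ∀ᶠ y in 𝓝 p.1, (y, p.2) ∈ O :=
  (Continuous.prodMk_left p.2).continuousAt.eventually_mem (hO.mem_nhds hp)

lemma exists_contDiffOn_nlap (hO : IsOpen O) (hF : ContDiffOn ℝ (⊤ : ℕ∞) F O) :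
    ∃ F' : EuclideanSpace ℝ (Fin n) × ℝ → ℝ, ContDiffOn ℝ (⊤ : ℕ∞) F' O ∧
      ∀ p ∈ O, nlap (fun y => F (y, p.2)) p.1 = F' p := by
  choose D hD hDeq using fun i => exists_contDiffOn_pderiv1 hO hF i
  choose D' hD' hDeq' using fun i => exists_contDiffOn_pderiv1 hO (hD i) i
  refine ⟨fun p => -∑ i, D' i p, (ContDiffOn.sum fun i _ => hD' i).neg, fun p hp => ?_⟩
  simp only [nlap, lap]
  congr 1
  refine Finset.sum_congr rfl fun i _ => ?_
  rw [← hDeq' i p hp]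
  refine EventuallyEq.eq_of_nhds (EventuallyEq.pderiv1 i ?_)
  filter_upwards [eventually_slice_mem hO hp] with y hy using hDeq i _ hy

lemma exists_contDiffOn_nlapIter (hO : IsOpen O) (hF : ContDiffOn ℝ (⊤ : ℕ∞) F O) (k : ℕ) :
    ∃ F' : EuclideanSpace ℝ (Fin n) × ℝ → ℝ, ContDiffOn ℝ (⊤ : ℕ∞) F' O ∧
      ∀ p ∈ O, nlapIter k (fun y => F (y, p.2)) p.1 = F' p := by
  induction k with
  | zero => exact ⟨F, hF, fun p _ => rfl⟩
  | succ k ih =>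
    obtain ⟨G, hG, hGeq⟩ := ih
    obtain ⟨G', hG', hGeq'⟩ := exists_contDiffOn_nlap hO hG
    refine ⟨G', hG', fun p hp => ?_⟩
    rw [nlapIter_succ, ← hGeq' p hp]
    refine EventuallyEq.eq_of_nhds (EventuallyEq.nlap ?_)
    filter_upwards [eventually_slice_mem hO hp] with y hy using hGeq _ hy

/-- Away from the origin, the derivatives of a truncated regularised logarithm are bounded
uniformly in the regularisation parameter. -/
lemma exists_abs_nlapIter_mul_log_le {χ : EuclideanSpace ℝ (Fin n) → ℝ}
    (hχ : ContDiff ℝ (⊤ : ℕ∞) χ) (hχc : HasCompactSupport χ) (k : ℕ) {ρ : ℝ} (hρ : 0 < ρ) :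
    ∃ C : ℝ, 0 ≤ C ∧ ∀ a : ℝ, 0 < a → a ≤ 1 → ∀ z, ρ ≤ ‖z‖ →
      |nlapIter k (fun y => χ y * -Real.log (‖y‖ ^ 2 + a)) z| ≤ C := by
  set O : Set (EuclideanSpace ℝ (Fin n) × ℝ) := {p | 0 < ‖p.1‖ ^ 2 + p.2}
  have hO : IsOpen O := isOpen_lt continuous_const (by fun_prop)
  have hF : ContDiffOn ℝ (⊤ : ℕ∞)
      (fun p : EuclideanSpace ℝ (Fin n) × ℝ => χ p.1 * -Real.log (‖p.1‖ ^ 2 + p.2)) O := by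
    refine (hχ.comp contDiff_fst).contDiffOn.mul (ContDiffOn.neg (ContDiffOn.log ?_ ?_))
    · exact (((contDiff_norm_sq ℝ).comp contDiff_fst).add contDiff_snd).contDiffOn
    · exact fun p (hp : 0 < ‖p.1‖ ^ 2 + p.2) => hp.ne'
  obtain ⟨F', hF', hF'eq⟩ := exists_contDiffOn_nlapIter hO hF k
  set K : Set (EuclideanSpace ℝ (Fin n) × ℝ) := (tsupport χ ∩ {z | ρ ≤ ‖z‖}) ×ˢ Set.Icc 0 1
  have hK : IsCompact K :=
    (hχc.isCompact.inter_right (isClosed_le continuous_const continuous_norm)).prod isCompact_Icc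
  have hKO : K ⊆ O := by
    rintro ⟨z, a⟩ ⟨⟨-, hz⟩, ha, -⟩
    have hz' : 0 < ‖z‖ := hρ.trans_le hz
    simp only [O, Set.mem_ofPred_eq]
    positivity
  obtain ⟨C, hC⟩ := hK.exists_bound_of_continuousOn (hF'.continuousOn.mono hKO)
  refine ⟨max C 0, le_max_right _ _, fun a ha ha1 z hz => ?_⟩
  by_cases hzs : z ∈ tsupport χ
  · have hmem : (z, a) ∈ K := ⟨⟨hzs, hz⟩, ha.le, ha1⟩
    rw [hF'eq (z, a) (hKO hmem)]
    exact (hC _ hmem).trans (le_max_left _ _)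
  · have h0 : (fun y => χ y * -Real.log (‖y‖ ^ 2 + a)) =ᶠ[𝓝 z] fun _ => 0 := by
      filter_upwards [notMem_tsupport_iff_eventuallyEq.1 hzs] with y hy
      simp [hy]
    rw [(h0.nlapIter k).eq_of_nhds, nlapIter_zero_fun]
    simp

end ParametricSmoothness

section ApproximateIdentity

open Filter Topology

lemma tendsto_zero_of_le_mul_add {I e : ℕ → ℝ} {q : ℝ} (hI : ∀ k, 0 ≤ I k) (hq0 : 0 ≤ q)
    (hq1 : q < 1) (h : ∀ k, I (k + 1) ≤ q * I k + e k) (he : Tendsto e atTop (𝓝 0)) :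
    Tendsto I atTop (𝓝 0) := by
  rw [Metric.tendsto_atTop]
  intro τ hτ
  have hpos : 0 < (1 - q) * (τ / 2) := mul_pos (by linarith) (by linarith)
  obtain ⟨K, hK⟩ := eventually_atTop.1 (he.eventually_le_const hpos)
  have hind : ∀ j, I (K + j) ≤ τ / 2 + q ^ j * I K := by
    intro j
    induction j with
    | zero => simp; linarith
    | succ j ih =>
      have h₁ := h (K + j)
      have h₂ := hK (K + j) (by omega)
      have h₃ := mul_le_mul_of_nonneg_left ih hq0
      rw [← add_assoc, pow_succ']
      linarith
  have hlim : Tendsto (fun j => q ^ j * I K) atTop (𝓝 0) := by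
    simpa using (tendsto_pow_atTop_nhds_zero_of_lt_one hq0 hq1).mul_const (I K)
  obtain ⟨J, hJ⟩ := eventually_atTop.1 (hlim.eventually_lt_const (half_pos hτ))
  refine ⟨K + J, fun k hk => ?_⟩
  obtain ⟨j, rfl⟩ := Nat.exists_eq_add_of_le (show K ≤ k by omega)
  rw [Real.dist_eq, sub_zero, abs_of_nonneg (hI _)]
  linarith [hind j, hJ j (by omega)]

variable {n : ℕ}

/-- The concentrating bubble `(δ / (‖z‖² + δ²))ⁿ`. -/
def bubble (δ : ℝ) (z : EuclideanSpace ℝ (Fin n)) : ℝ :=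
  (δ * (‖z‖ ^ 2 + δ ^ 2)⁻¹) ^ n

lemma bubble_nonneg {δ : ℝ} (hδ : 0 < δ) (z : EuclideanSpace ℝ (Fin n)) : 0 ≤ bubble δ z := by
  unfold bubble
  positivity

lemma continuous_bubble {δ : ℝ} (hδ : 0 < δ) :
    Continuous (bubble δ : EuclideanSpace ℝ (Fin n) → ℝ) := by
  unfold bubble
  exact (continuous_const.mul ((by fun_prop : Continuous fun z : EuclideanSpace ℝ (Fin n) =>
    ‖z‖ ^ 2 + δ ^ 2).inv₀ fun z => by positivity)).pow n

lemma bubble_le {δ : ℝ} (hδ : 0 < δ) (z : EuclideanSpace ℝ (Fin n)) :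
    bubble δ z ≤ (1 / δ) ^ n := by
  unfold bubble
  gcongr
  rw [← div_eq_mul_inv, div_le_div_iff₀ (by positivity) hδ]
  nlinarith [sq_nonneg ‖z‖]

lemma le_bubble {δ : ℝ} (hδ : 0 < δ) {z : EuclideanSpace ℝ (Fin n)} (hz : ‖z‖ ≤ δ) :
    (1 / (2 * δ)) ^ n ≤ bubble δ z := by
  unfold bubble
  gcongr
  rw [← div_eq_mul_inv, div_le_div_iff₀ (by positivity) (by positivity)]
  nlinarith [norm_nonneg z]

lemma bubble_half_le (hn : 0 < n) {δ : ℝ} (hδ : 0 < δ) {z : EuclideanSpace ℝ (Fin n)}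
    (hz : δ ≤ ‖z‖) : bubble (δ / 2) z ≤ 4 / 5 * bubble δ z := by
  unfold bubble
  have h₁ : δ / 2 * (‖z‖ ^ 2 + (δ / 2) ^ 2)⁻¹ ≤ 4 / 5 * (δ * (‖z‖ ^ 2 + δ ^ 2)⁻¹) := by
    rw [← div_eq_mul_inv, ← div_eq_mul_inv, ← mul_div_assoc,
      div_le_div_iff₀ (by positivity) (by positivity)]
    have : δ ^ 2 ≤ ‖z‖ ^ 2 := by gcongr
    nlinarith
  have h₂ : ((4 : ℝ) / 5) ^ n ≤ 4 / 5 := pow_le_of_le_one (by norm_num) (by norm_num) hn.ne'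
  calc (δ / 2 * (‖z‖ ^ 2 + (δ / 2) ^ 2)⁻¹) ^ n
      ≤ (4 / 5 * (δ * (‖z‖ ^ 2 + δ ^ 2)⁻¹)) ^ n := by gcongr
    _ ≤ 4 / 5 * (δ * (‖z‖ ^ 2 + δ ^ 2)⁻¹) ^ n := by
      rw [mul_pow]
      gcongr

lemma volume_real_closedBall (x : EuclideanSpace ℝ (Fin n)) {δ : ℝ} (hδ : 0 ≤ δ) :
    volume.real (closedBall x δ) =
      δ ^ n * volume.real (ball (0 : EuclideanSpace ℝ (Fin n)) 1) := by
  simpa using Measure.addHaar_real_closedBall volume x hδ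

lemma volume_real_unitBall_pos :
    0 < volume.real (ball (0 : EuclideanSpace ℝ (Fin n)) 1) :=
  ENNReal.toReal_pos (measure_ball_pos _ _ one_pos).ne' measure_ball_lt_top.ne

lemma integrableOn_mul_bubble {s : Set (EuclideanSpace ℝ (Fin n))}
    {g : EuclideanSpace ℝ (Fin n) → ℝ} (hg : IntegrableOn g s) {δ : ℝ} (hδ : 0 < δ)
    (x : EuclideanSpace ℝ (Fin n)) : IntegrableOn (fun y => g y * bubble δ (y - x)) s := by
  refine Integrable.mul_bdd (c := (1 / δ) ^ n) hg
    ((continuous_bubble hδ).comp (continuous_sub_right x)).aestronglyMeasurable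
    (ae_of_all _ fun y => ?_)
  rw [Real.norm_of_nonneg (bubble_nonneg hδ _)]
  exact bubble_le hδ _

/-- Bubbles concentrating at `x` do not see a nonnegative function whose averages on small balls
around `x` tend to zero. -/
lemma tendsto_setIntegral_mul_bubble (hn : 0 < n) {x : EuclideanSpace ℝ (Fin n)} {ρ : ℝ}
    (hρ : 0 < ρ) {g : EuclideanSpace ℝ (Fin n) → ℝ} (hg0 : ∀ y, 0 ≤ g y)
    (hg : IntegrableOn g (closedBall x ρ))
    (hlim : Tendsto (fun k : ℕ => ⨍ y in closedBall x (ρ / 2 ^ k), g y) atTop (𝓝 0)) :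
    Tendsto (fun k : ℕ => ∫ y in closedBall x ρ, g y * bubble (ρ / 2 ^ k) (y - x))
      atTop (𝓝 0) := by
  have hδ : ∀ k : ℕ, 0 < ρ / 2 ^ k := fun k => by positivity
  have hint : ∀ k : ℕ, IntegrableOn (fun y => g y * bubble (ρ / 2 ^ k) (y - x))
      (closedBall x ρ) := fun k => integrableOn_mul_bubble hg (hδ k) x
  have hsub : ∀ k : ℕ, closedBall x (ρ / 2 ^ k) ⊆ closedBall x ρ := fun k =>
    closedBall_subset_closedBall (div_le_self hρ.le (one_le_pow₀ one_le_two))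
  refine tendsto_zero_of_le_mul_add (q := 4 / 5)
    (e := fun k => 2 ^ n * volume.real (ball (0 : EuclideanSpace ℝ (Fin n)) 1) *
      ⨍ y in closedBall x (ρ / 2 ^ k), g y)
    (fun k => integral_nonneg fun y => mul_nonneg (hg0 y) (bubble_nonneg (hδ k) _))
    (by norm_num) (by norm_num) (fun k => ?_) (by simpa using hlim.const_mul _)
  have hhalf : ρ / 2 ^ (k + 1) = ρ / 2 ^ k / 2 := by rw [pow_succ]; field_simp
  have hint_k := hint k
  have hint_succ := hint (k + 1)
  have hsub_k := hsub k
  have hδk := hδ k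
  rw [hhalf] at hint_succ
  simp only [hhalf]
  generalize ρ / 2 ^ k = δ at *
  have havg : 2 ^ n * volume.real (ball (0 : EuclideanSpace ℝ (Fin n)) 1) *
      ⨍ y in closedBall x δ, g y =
      ∫ y in closedBall x ρ, (closedBall x δ).indicator (fun y => (2 / δ) ^ n * g y) y := by
    rw [setIntegral_indicator measurableSet_closedBall,
      Set.inter_eq_self_of_subset_right hsub_k, integral_const_mul, setAverage_eq,
      volume_real_closedBall x hδk.le, smul_eq_mul]
    have := (volume_real_unitBall_pos (n := n)).ne'
    rw [div_pow]
    field_simp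
  have hint' : IntegrableOn ((closedBall x δ).indicator fun y => (2 / δ) ^ n * g y)
      (closedBall x ρ) :=
    IntegrableOn.indicator (hg.const_mul _) measurableSet_closedBall
  rw [havg, ← integral_const_mul, ← integral_add (hint_k.const_mul _) hint']
  refine integral_mono hint_succ
    ((hint_k.const_mul _).add hint') fun y => ?_
  simp only
  have hb := bubble_nonneg hδk (y - x)
  by_cases hy : y ∈ closedBall x δ
  · rw [Set.indicator_of_mem hy]
    have h₁ := bubble_le (half_pos hδk) (y - x)
    rw [one_div_div] at h₁
    nlinarith [mul_le_mul_of_nonneg_left h₁ (hg0 y), mul_nonneg (hg0 y) hb]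
  · rw [Set.indicator_of_notMem hy, add_zero]
    have hy' : δ ≤ ‖y - x‖ := by
      rw [mem_closedBall, dist_eq_norm] at hy
      linarith
    nlinarith [mul_le_mul_of_nonneg_left (bubble_half_le hn hδk hy') (hg0 y)]

/-- At almost every point, a locally integrable function is controlled by any uniform bound for
its integrals against concentrating bubbles. -/
lemma ae_abs_le_of_abs_setIntegral_mul_bubble_le (hn : 0 < n) {ρ : ℝ} (hρ : 0 < ρ)
    {V : EuclideanSpace ℝ (Fin n) → ℝ} (hV : LocallyIntegrable V) :
    ∀ᵐ x, ∀ H : ℝ,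
      (∀ k : ℕ, |∫ y in closedBall x ρ, V y * bubble (ρ / 2 ^ k) (y - x)| ≤ H) →
      volume.real (ball (0 : EuclideanSpace ℝ (Fin n)) 1) / 2 ^ n * |V x| ≤ H := by
  filter_upwards [IsUnifLocDoublingMeasure.ae_tendsto_average_norm_sub volume hV 1] with x hx H hH
  have hδ : ∀ k : ℕ, 0 < ρ / 2 ^ k := fun k => by positivity
  have hδlim : Tendsto (fun k : ℕ => ρ / 2 ^ k) atTop (𝓝[>] 0) := by
    refine tendsto_nhdsWithin_iff.2 ⟨?_, Eventually.of_forall hδ⟩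
    exact tendsto_const_nhds.div_atTop (tendsto_pow_atTop_atTop_of_one_lt one_lt_two)
  have hVρ : IntegrableOn V (closedBall x ρ) := hV.integrableOn_isCompact (isCompact_closedBall x ρ)
  have hcρ : IntegrableOn (fun _ => V x) (closedBall x ρ) :=
    integrableOn_const measure_closedBall_lt_top.ne
  have hlim := tendsto_setIntegral_mul_bubble hn hρ (fun y => norm_nonneg (V y - V x))
    (hVρ.sub hcρ).norm
    (hx (fun _ => x) _ hδlim (Eventually.of_forall fun k => by simpa using (hδ k).le))
  refine ge_of_tendsto (by simpa using hlim.const_add H) (Eventually.of_forall fun k => ?_)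
  set δ := ρ / 2 ^ k with hδdef
  have hδk : 0 < δ := hδ k
  have hsub : closedBall x δ ⊆ closedBall x ρ :=
    closedBall_subset_closedBall (div_le_self hρ.le (one_le_pow₀ one_le_two))
  have hb : IntegrableOn (fun y => bubble δ (y - x)) (closedBall x ρ) := by
    simpa using integrableOn_mul_bubble
      (integrableOn_const (C := (1 : ℝ)) (measure_closedBall_lt_top (x := x) (r := ρ)).ne) hδk x
  have hκ : volume.real (ball (0 : EuclideanSpace ℝ (Fin n)) 1) / 2 ^ n ≤
      ∫ y in closedBall x ρ, bubble δ (y - x) := by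
    calc volume.real (ball (0 : EuclideanSpace ℝ (Fin n)) 1) / 2 ^ n
        = ∫ _ in closedBall x δ, (1 / (2 * δ)) ^ n := by
          rw [setIntegral_const, volume_real_closedBall x hδk.le, smul_eq_mul,
            div_pow 1 (2 * δ), mul_pow, one_pow]
          field_simp
      _ ≤ ∫ y in closedBall x δ, bubble δ (y - x) := by
          refine setIntegral_mono_on (integrableOn_const measure_closedBall_lt_top.ne)
            (hb.mono_set hsub) measurableSet_closedBall fun y hy => le_bubble hδk ?_
          rwa [mem_closedBall, dist_eq_norm] at hy
      _ ≤ ∫ y in closedBall x ρ, bubble δ (y - x) :=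
          setIntegral_mono_set hb (ae_of_all _ fun y => bubble_nonneg hδk _)
            hsub.eventuallyLE
  have hsplit : (∫ y in closedBall x ρ, bubble δ (y - x)) * V x =
      (∫ y in closedBall x ρ, V y * bubble δ (y - x)) -
        ∫ y in closedBall x ρ, (V y - V x) * bubble δ (y - x) := by
    rw [← integral_sub (integrableOn_mul_bubble hVρ hδk x)
      (integrableOn_mul_bubble (g := fun y => V y - V x) (hVρ.sub hcρ) hδk x),
      ← integral_mul_const]
    congr 1
    ext y
    ring
  have hrem : |∫ y in closedBall x ρ, (V y - V x) * bubble δ (y - x)| ≤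
      ∫ y in closedBall x ρ, ‖V y - V x‖ * bubble δ (y - x) := by
    refine (abs_integral_le_integral_abs).trans_eq ?_
    congr 1
    ext y
    rw [abs_mul, abs_of_nonneg (bubble_nonneg hδk _), Real.norm_eq_abs]
  calc volume.real (ball (0 : EuclideanSpace ℝ (Fin n)) 1) / 2 ^ n * |V x|
      ≤ |∫ y in closedBall x ρ, bubble δ (y - x)| * |V x| := by
        gcongr
        exact hκ.trans (le_abs_self _)
    _ = |(∫ y in closedBall x ρ, bubble δ (y - x)) * V x| := (abs_mul _ _).symm
    _ ≤ |∫ y in closedBall x ρ, V y * bubble δ (y - x)| +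
        |∫ y in closedBall x ρ, (V y - V x) * bubble δ (y - x)| := by
        rw [hsplit]
        exact abs_sub _ _
    _ ≤ H + ∫ y in closedBall x ρ, ‖V y - V x‖ * bubble δ (y - x) := add_le_add (hH k) hrem

end ApproximateIdentity

section LogPotential

open Filter Topology

/-- Jensen's inequality for the exponential and a weight of total mass at most one. -/
lemma exp_integral_mul_le {α : Type*} [MeasurableSpace α] {μ : Measure α} {w g : α → ℝ}
    (hw0 : ∀ y, 0 ≤ w y) (hw : Integrable w μ) (hw1 : ∫ y, w y ∂μ ≤ 1)
    (hwg : Integrable (fun y => w y * g y) μ)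
    (hwe : Integrable (fun y => w y * Real.exp (g y)) μ) :
    Real.exp (∫ y, w y * g y ∂μ) ≤ 1 + ∫ y, w y * Real.exp (g y) ∂μ := by
  set t := ∫ y, w y * g y ∂μ with ht
  have hpt : ∀ y, Real.exp t * ((1 - t) * w y + w y * g y) ≤ w y * Real.exp (g y) := by
    intro y
    have h := mul_le_mul_of_nonneg_left (Real.add_one_le_exp (g y - t))
      (mul_nonneg (hw0 y) (Real.exp_pos t).le)
    rw [mul_assoc (w y) _ (Real.exp _), ← Real.exp_add, add_sub_cancel] at h
    linarith
  have hint := integral_mono (((hw.const_mul (1 - t)).add hwg).const_mul (Real.exp t)) hwe hpt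
  rw [integral_const_mul, integral_add' (hw.const_mul _) hwg, integral_const_mul, ← ht] at hint
  have h1 : Real.exp t * (1 - t) ≤ 1 := by
    have h := mul_le_mul_of_nonneg_left (Real.one_sub_le_exp_neg t) (Real.exp_pos t).le
    rwa [← Real.exp_add, add_neg_cancel, Real.exp_zero] at h
  have hW : 0 ≤ ∫ y, w y ∂μ := integral_nonneg hw0
  nlinarith [mul_le_mul_of_nonneg_left h1 (sub_nonneg.2 hw1)]

variable {n : ℕ}

/-- The truncated logarithmic kernel `log⁺ (2 / ‖z‖)`. -/
def logKernel (z : EuclideanSpace ℝ (Fin n)) : ℝ := Real.posLog (2 / ‖z‖)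

/-- The kernel `2 / ‖z‖`, truncated at radius `2`, which dominates `logKernel`. -/
def invKernel : EuclideanSpace ℝ (Fin n) → ℝ :=
  (closedBall 0 2).indicator fun z => 2 / ‖z‖

lemma logKernel_nonneg (z : EuclideanSpace ℝ (Fin n)) : 0 ≤ logKernel z := Real.posLog_nonneg

lemma invKernel_nonneg (z : EuclideanSpace ℝ (Fin n)) : 0 ≤ invKernel z :=
  Set.indicator_nonneg (fun _ _ => by positivity) z

lemma measurable_logKernel : Measurable (logKernel : EuclideanSpace ℝ (Fin n) → ℝ) := by
  unfold logKernel Real.posLog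
  fun_prop

lemma logKernel_of_two_lt {z : EuclideanSpace ℝ (Fin n)} (hz : 2 < ‖z‖) : logKernel z = 0 := by
  rw [logKernel, Real.posLog_eq_zero_iff, abs_of_nonneg (by positivity)]
  exact (div_le_one (by linarith)).2 hz.le

lemma exp_logKernel_le (z : EuclideanSpace ℝ (Fin n)) :
    Real.exp (logKernel z) ≤ 1 + invKernel z := by
  by_cases hz : ‖z‖ ≤ 2
  · rw [invKernel, Set.indicator_of_mem (by simpa using hz)]
    rcases eq_or_ne z 0 with rfl | h0
    · simp [logKernel]
    have hpos : 0 < ‖z‖ := norm_pos_iff.2 h0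
    rw [logKernel, Real.posLog_eq_log (by
      rw [abs_of_nonneg (by positivity)]
      exact (one_le_div hpos).2 hz), Real.exp_log (by positivity)]
    linarith
  · rw [logKernel_of_two_lt (not_le.1 hz), Real.exp_zero]
    linarith [invKernel_nonneg z]

lemma logKernel_le_invKernel (z : EuclideanSpace ℝ (Fin n)) : logKernel z ≤ invKernel z := by
  linarith [Real.add_one_le_exp (logKernel z), exp_logKernel_le z]

lemma integrable_invKernel (hn : 2 ≤ n) :
    Integrable (invKernel : EuclideanSpace ℝ (Fin n) → ℝ) := by
  refine (integrable_indicator_iff measurableSet_closedBall).2 ?_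
  refine IntegrableOn.mono_set (t := ball 0 3) ?_ (closedBall_subset_ball (by norm_num))
  refine integrableOn_ball_of_norm_le_rpow (C := 2) (α := 1) (by simp; omega)
    (by simp; omega) (ae_of_all _ fun z => ?_) ?_
  · rw [Real.norm_of_nonneg (by positivity), Real.rpow_neg_one, div_eq_mul_inv]
  · exact (measurable_const.div measurable_norm).aestronglyMeasurable

lemma integrable_logKernel (hn : 2 ≤ n) :
    Integrable (logKernel : EuclideanSpace ℝ (Fin n) → ℝ) :=
  (integrable_invKernel hn).mono' measurable_logKernel.aestronglyMeasurable
    (ae_of_all _ fun z => by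
      rw [Real.norm_of_nonneg (logKernel_nonneg z)]
      exact logKernel_le_invKernel z)

/-- For almost every `x`, an integrable function is integrable against `invKernel (x - ·)`. -/
lemma ae_integrable_mul_invKernel (hn : 2 ≤ n) {F : EuclideanSpace ℝ (Fin n) → ℝ}
    (hF : Integrable F) : ∀ᵐ x, Integrable fun y => F y * invKernel (x - y) :=
  hF.ae_convolution_exists (ContinuousLinearMap.mul ℝ ℝ) (integrable_invKernel hn)

lemma integrable_integral_mul_invKernel (hn : 2 ≤ n) {F : EuclideanSpace ℝ (Fin n) → ℝ}
    (hF : Integrable F) : Integrable fun x => ∫ y, F y * invKernel (x - y) :=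
  hF.integrable_convolution (ContinuousLinearMap.mul ℝ ℝ) (integrable_invKernel hn)

lemma integrable_mul_logKernel {F : EuclideanSpace ℝ (Fin n) → ℝ}
    (hF : AEStronglyMeasurable F) {x : EuclideanSpace ℝ (Fin n)}
    (h : Integrable fun y => F y * invKernel (x - y)) :
    Integrable fun y => F y * logKernel (x - y) := by
  refine h.norm.mono' (hF.mul (measurable_logKernel.comp
    (measurable_const.sub measurable_id)).aestronglyMeasurable) (ae_of_all _ fun y => ?_)
  simp only [norm_mul, Real.norm_of_nonneg (logKernel_nonneg _),
    Real.norm_of_nonneg (invKernel_nonneg _)]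
  exact mul_le_mul_of_nonneg_left (logKernel_le_invKernel _) (norm_nonneg _)

/-- Logarithmic potentials of weights of mass at most one are exponentially integrable: a pointwise
bound. -/
lemma exp_integral_mul_logKernel_le {w : EuclideanSpace ℝ (Fin n) → ℝ}
    (hw0 : ∀ y, 0 ≤ w y) (hw : Integrable w) (hw1 : ∫ y, w y ≤ 1) {x : EuclideanSpace ℝ (Fin n)}
    (hx : Integrable fun y => w y * invKernel (x - y)) :
    Real.exp (∫ y, w y * logKernel (x - y)) ≤ 2 + ∫ y, w y * invKernel (x - y) := by
  have hle : ∀ y, w y * Real.exp (logKernel (x - y)) ≤ w y + w y * invKernel (x - y) := fun y => by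
    have := mul_le_mul_of_nonneg_left (exp_logKernel_le (x - y)) (hw0 y)
    linarith
  have hexp : Integrable fun y => w y * Real.exp (logKernel (x - y)) := by
    refine (hw.add hx).mono' (hw.aestronglyMeasurable.mul (Real.measurable_exp.comp
      (measurable_logKernel.comp (measurable_const.sub measurable_id))).aestronglyMeasurable)
      (ae_of_all _ fun y => ?_)
    rw [Real.norm_of_nonneg (mul_nonneg (hw0 y) (Real.exp_pos _).le)]
    exact hle y
  have h₁ := exp_integral_mul_le hw0 hw hw1 (integrable_mul_logKernel hw.aestronglyMeasurable hx)
    hexp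
  have h₂ := integral_mono hexp (hw.add hx) hle
  rw [integral_add' hw hx] at h₂
  linarith

/-- A function dominated by the logarithmic potential of an integrable function has all
exponential moments. -/
lemma integrableOn_exp_of_le_logPotential (hn : 2 ≤ n) {s : Set (EuclideanSpace ℝ (Fin n))}
    (hs : MeasurableSet s) (hsv : volume s ≠ ⊤) {v F : EuclideanSpace ℝ (Fin n) → ℝ}
    (hv : AEStronglyMeasurable v (volume.restrict s)) (hF : Integrable F) {κ C : ℝ} (hκ : 0 < κ)
    (hvF : ∀ᵐ x, x ∈ s → (Integrable fun y => F y * logKernel (x - y)) →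
      κ * |v x| ≤ C + ∫ y, |F y| * logKernel (x - y)) {p : ℝ} (hp : 0 < p) :
    IntegrableOn (fun x => Real.exp (p * |v x|)) s := by
  obtain ⟨g, hgc, hgF, hgcont, hgint⟩ :=
    hF.exists_hasCompactSupport_integral_sub_le (div_pos hκ hp)
  obtain ⟨M, hM⟩ := hgc.exists_bound_of_continuous hgcont
  have hM0 : 0 ≤ M := (norm_nonneg _).trans (hM 0)
  set w : EuclideanSpace ℝ (Fin n) → ℝ := fun y => p / κ * |F y - g y|
  have hw0 : ∀ y, 0 ≤ w y := fun y => by positivity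
  have hw : Integrable w := (hF.sub hgint).abs.const_mul _
  have hw1 : ∫ y, w y ≤ 1 := by
    simp only [w, integral_const_mul]
    calc p / κ * ∫ y, |F y - g y| ≤ p / κ * (κ / p) := by
          gcongr
          exact hgF
      _ = 1 := by field_simp
  set L := ∫ z : EuclideanSpace ℝ (Fin n), logKernel z
  set D := p / κ * (C + M * L)
  have hbound : ∀ᵐ x, x ∈ s →
      Real.exp (p * |v x|) ≤ Real.exp D * (2 + ∫ y, w y * invKernel (x - y)) := by
    filter_upwards [hvF, ae_integrable_mul_invKernel hn hF, ae_integrable_mul_invKernel hn hw]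
      with x hx hFx hwx hxs
    have hFx' := integrable_mul_logKernel hF.aestronglyMeasurable hFx
    have hwx' := integrable_mul_logKernel hw.aestronglyMeasurable hwx
    have hL : Integrable fun y => logKernel (x - y) := (integrable_logKernel hn).comp_sub_left x
    have hle : ∫ y, |F y| * logKernel (x - y) ≤ M * L + κ / p * ∫ y, w y * logKernel (x - y) := by
      have h := integral_mono (f := fun y => |F y| * logKernel (x - y))
        (g := fun y => M * logKernel (x - y) + κ / p * (w y * logKernel (x - y)))
        (hFx'.abs.congr (ae_of_all _ fun y => by
          simp only [abs_mul, abs_of_nonneg (logKernel_nonneg _)]))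
        ((hL.const_mul M).add (hwx'.const_mul _)) fun y => ?_
      · rwa [integral_add (hL.const_mul M) (hwx'.const_mul _), integral_const_mul,
          integral_const_mul, integral_sub_left_eq_self (fun z => logKernel z)] at h
      · have h₁ : |F y| ≤ M + |F y - g y| := by
          have h₂ := abs_add_le (g y) (F y - g y)
          rw [add_sub_cancel] at h₂
          linarith [hM y, Real.norm_eq_abs (g y)]
        have h₃ := mul_le_mul_of_nonneg_right h₁ (logKernel_nonneg (x - y))
        have h₄ : κ / p * (w y * logKernel (x - y)) = |F y - g y| * logKernel (x - y) := by
          simp only [w]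
          field_simp
        simp only [h₄]
        linarith
    have hpv : p * |v x| ≤ D + ∫ y, w y * logKernel (x - y) := by
      have h := mul_le_mul_of_nonneg_left ((hx hxs hFx').trans (add_le_add_right hle C))
        (div_pos hp hκ).le
      calc p * |v x| = p / κ * (κ * |v x|) := by field_simp
        _ ≤ _ := h
        _ = _ := by simp only [D]; field_simp; ring
    calc Real.exp (p * |v x|) ≤ Real.exp (D + ∫ y, w y * logKernel (x - y)) := by gcongr
      _ = Real.exp D * Real.exp (∫ y, w y * logKernel (x - y)) := Real.exp_add _ _
      _ ≤ _ := by
        gcongr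
        exact exp_integral_mul_logKernel_le hw0 hw hw1 hwx
  refine Integrable.mono' (g := fun x => Real.exp D * (2 + ∫ y, w y * invKernel (x - y))) ?_ ?_ ?_
  · exact ((integrableOn_const hsv).add
      (integrable_integral_mul_invKernel hn hw).integrableOn).const_mul _
  · exact Real.continuous_exp.comp_aestronglyMeasurable (hv.norm.const_mul p)
  · refine (ae_restrict_iff' hs).2 ?_
    filter_upwards [hbound] with x hx hxs
    rw [Real.norm_of_nonneg (Real.exp_pos _).le]
    exact hx hxs

end LogPotential

section Potential

open Filter Topology

variable {n : ℕ}

lemma ContDiff.nlapIter {G : EuclideanSpace ℝ (Fin n) → ℝ} (hG : ContDiff ℝ (⊤ : ℕ∞) G) (k : ℕ) :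
    ContDiff ℝ (⊤ : ℕ∞) (nlapIter k G) := by
  obtain ⟨F', hF', hF'eq⟩ := exists_contDiffOn_nlapIter (F := fun p => G p.1) isOpen_univ
    (hG.comp contDiff_fst).contDiffOn k
  have h : _root_.nlapIter k G = fun z => F' (z, 0) :=
    funext fun z => hF'eq (z, 0) (Set.mem_univ _)
  rw [h]
  exact (contDiffOn_univ.1 hF').comp (contDiff_id.prodMk contDiff_const)

lemma nlapIter_eq_zero_of_notMem_tsupport {G : EuclideanSpace ℝ (Fin n) → ℝ} (k : ℕ)
    {z : EuclideanSpace ℝ (Fin n)} (hz : z ∉ tsupport G) : nlapIter k G z = 0 := by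
  have h0 : G =ᶠ[𝓝 z] fun _ => 0 := notMem_tsupport_iff_eventuallyEq.1 hz
  rw [(h0.nlapIter k).eq_of_nhds, nlapIter_zero_fun]

/-- A distributional equation, tested against a translated test function supported where the
data are not truncated. -/
lemma integral_indicator_mul_nlapIter_sub {m : ℕ} {Ω B : Set (EuclideanSpace ℝ (Fin n))}
    {f v G : EuclideanSpace ℝ (Fin n) → ℝ} {x : EuclideanSpace ℝ (Fin n)} {ε : ℝ}
    (hΩ : MeasurableSet Ω)
    (heq : ∀ η : EuclideanSpace ℝ (Fin n) → ℝ, ContDiff ℝ (⊤ : ℕ∞) η →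
      HasCompactSupport η → tsupport η ⊆ Ω →
      ∫ y in Ω, v y * nlapIter m η y = ∫ y in Ω, f y * η y)
    (hG : ContDiff ℝ (⊤ : ℕ∞) G) (hGs : tsupport G ⊆ closedBall 0 ε)
    (hxB : closedBall x ε ⊆ B) (hBΩ : B ⊆ Ω) :
    ∫ y, B.indicator v y * nlapIter m G (y - x) = ∫ y, B.indicator f y * G (y - x) := by
  have hout : ∀ {y}, y ∉ B → y - x ∉ tsupport G := fun {y} hy h =>
    hy (hxB (by simpa [dist_eq_norm] using hGs h))
  have hsupp : tsupport (fun y => G (y - x)) ⊆ closedBall x ε := by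
    refine closure_minimal (fun y hy => ?_) isClosed_closedBall
    simpa [dist_eq_norm] using hGs (subset_tsupport G hy)
  have hη := heq (fun y => G (y - x)) (hG.comp (contDiff_id.sub contDiff_const))
    (HasCompactSupport.of_support_subset_isCompact (isCompact_closedBall x ε)
      ((subset_tsupport _).trans hsupp)) (hsupp.trans (hxB.trans hBΩ))
  rw [nlapIter_comp_sub] at hη
  have key : ∀ (g N : EuclideanSpace ℝ (Fin n) → ℝ), (∀ z, z ∉ tsupport G → N z = 0) →
      ∫ y, B.indicator g y * N (y - x) = ∫ y in Ω, g y * N (y - x) := fun g N hN => by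
    rw [← integral_indicator hΩ]
    refine integral_congr_ae (ae_of_all _ fun y => ?_)
    by_cases hyB : y ∈ B
    · simp [hyB, hBΩ hyB]
    · by_cases hyΩ : y ∈ Ω <;> simp [hyB, hyΩ, hN _ (hout hyB)]
  rw [key v _ fun z => nlapIter_eq_zero_of_notMem_tsupport m,
    key f G fun z hz => image_eq_zero_of_notMem_tsupport hz]
  exact hη

lemma abs_log_norm_sq_add_le {z : EuclideanSpace ℝ (Fin n)} (hz : z ≠ 0) (hz1 : ‖z‖ ≤ 1)
    {a : ℝ} (ha : 0 < a) (ha1 : a ≤ 1) : |Real.log (‖z‖ ^ 2 + a)| ≤ 2 * logKernel z := by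
  have hpos : 0 < ‖z‖ := norm_pos_iff.2 hz
  have hk : logKernel z = Real.log 2 - Real.log ‖z‖ := by
    rw [logKernel, Real.posLog_eq_log, Real.log_div two_ne_zero hpos.ne']
    rw [abs_of_pos (by positivity), le_div_iff₀ hpos]
    linarith
  have h2 : 0 < Real.log 2 := Real.log_pos one_lt_two
  have hl : Real.log ‖z‖ ≤ 0 := Real.log_nonpos hpos.le hz1
  have hlow : 2 * Real.log ‖z‖ ≤ Real.log (‖z‖ ^ 2 + a) := by
    have := Real.log_le_log (by positivity : 0 < ‖z‖ ^ 2) (by linarith : ‖z‖ ^ 2 ≤ ‖z‖ ^ 2 + a)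
    rwa [Real.log_pow, Nat.cast_ofNat] at this
  have hup : Real.log (‖z‖ ^ 2 + a) ≤ Real.log 2 :=
    Real.log_le_log (by positivity) (by nlinarith)
  rw [hk, abs_le]
  constructor <;> linarith

lemma nlapIter_mul_neg_log_eq_bubble {m : ℕ} (hm : 0 < m) {δ : ℝ} (hδ : 0 < δ)
    {χ : EuclideanSpace ℝ (Fin (2 * m)) → ℝ} {z : EuclideanSpace ℝ (Fin (2 * m))}
    (hχ : χ =ᶠ[𝓝 z] fun _ => 1) :
    nlapIter m (fun y => χ y * -Real.log (‖y‖ ^ 2 + δ ^ 2)) z =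
      4 ^ m * (2 * m - 1).factorial * bubble δ z := by
  have h : (fun y => χ y * -Real.log (‖y‖ ^ 2 + δ ^ 2)) =ᶠ[𝓝 z]
      fun y => -Real.log (‖y‖ ^ 2 + δ ^ 2) := by
    filter_upwards [hχ] with y hy
    rw [hy, one_mul]
  rw [(h.nlapIter m).eq_of_nhds, nlapIter_neg_log hm (by positivity)]
  simp only [bubble, mul_pow, ← pow_mul]

/-- The average of a solution of `(-Δ)^m V = F` against a bubble is controlled by the logarithmic
potential of `F`. -/
lemma abs_setIntegral_mul_bubble_le_logPotential {m : ℕ} (hm : 0 < m)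
    {χ V F : EuclideanSpace ℝ (Fin (2 * m)) → ℝ} {x : EuclideanSpace ℝ (Fin (2 * m))}
    {ρ C δ : ℝ} (hδ : 0 < δ) (hδ1 : δ ≤ 1)
    (hχ : ContDiff ℝ (⊤ : ℕ∞) χ) (hχs : tsupport χ ⊆ closedBall 0 1) (hχ1 : ∀ z, |χ z| ≤ 1)
    (hχρ : ∀ z, ‖z‖ ≤ ρ → χ =ᶠ[𝓝 z] fun _ => 1) (hV : Integrable V)
    (hC : ∀ z, ρ ≤ ‖z‖ → |nlapIter m (fun y => χ y * -Real.log (‖y‖ ^ 2 + δ ^ 2)) z| ≤ C)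
    (hC0 : 0 ≤ C)
    (hVF : ∫ y, V y * nlapIter m (fun y => χ y * -Real.log (‖y‖ ^ 2 + δ ^ 2)) (y - x) =
      ∫ y, F y * (χ (y - x) * -Real.log (‖y - x‖ ^ 2 + δ ^ 2)))
    (hF : Integrable fun y => F y * logKernel (x - y)) :
    |∫ y in closedBall x ρ, V y * bubble δ (y - x)| ≤
      C * (∫ y, |V y|) + 2 * ∫ y, |F y| * logKernel (x - y) := by
  set G : EuclideanSpace ℝ (Fin (2 * m)) → ℝ := fun y => χ y * -Real.log (‖y‖ ^ 2 + δ ^ 2) with hGd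
  set c : ℝ := 4 ^ m * (2 * m - 1).factorial with hc
  have hc1 : 1 ≤ c := by
    have h1 : (1 : ℝ) ≤ 4 ^ m := one_le_pow₀ (by norm_num)
    have h2 : (1 : ℝ) ≤ ((2 * m - 1).factorial : ℝ) := by
      exact_mod_cast Nat.one_le_iff_ne_zero.2 (Nat.factorial_ne_zero _)
    exact one_le_mul_of_one_le_of_one_le h1 h2
  have hball : ∀ y ∈ closedBall x ρ, V y * nlapIter m G (y - x) = c * (V y * bubble δ (y - x)) := by
    intro y hy
    rw [hGd, nlapIter_mul_neg_log_eq_bubble hm hδ (hχρ _ (by simpa [dist_eq_norm] using hy))]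
    ring
  have hcompl : ∀ y ∈ (closedBall x ρ)ᶜ, ‖V y * nlapIter m G (y - x)‖ ≤ C * |V y| := by
    intro y hy
    have hy' : ρ ≤ ‖y - x‖ := by
      have : ρ < ‖y - x‖ := by simpa [dist_eq_norm] using hy
      exact this.le
    rw [norm_mul, mul_comm]
    exact mul_le_mul_of_nonneg_right (hC _ hy') (abs_nonneg _)
  have hG : ContDiff ℝ (⊤ : ℕ∞) G :=
    hχ.mul (((contDiff_norm_sq ℝ).add contDiff_const).log fun y => by positivity).neg
  have hNm : AEStronglyMeasurable (fun y => V y * nlapIter m G (y - x)) :=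
    hV.aestronglyMeasurable.mul
      ((hG.nlapIter m).continuous.comp (continuous_sub_right x)).aestronglyMeasurable
  have hi₁ : IntegrableOn (fun y => V y * nlapIter m G (y - x)) (closedBall x ρ) :=
    IntegrableOn.congr_fun ((integrableOn_mul_bubble hV.integrableOn hδ x).const_mul c)
      (fun y hy => (hball y hy).symm) measurableSet_closedBall
  have hi₂ : IntegrableOn (fun y => V y * nlapIter m G (y - x)) (closedBall x ρ)ᶜ :=
    Integrable.mono' (hV.abs.const_mul C).integrableOn hNm.restrict
      (ae_restrict_of_forall_mem measurableSet_closedBall.compl hcompl)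
  have hi : Integrable fun y => V y * nlapIter m G (y - x) := by
    rw [← integrableOn_univ, ← Set.union_compl_self (closedBall x ρ)]
    exact hi₁.union hi₂
  have hsplit := integral_add_compl (s := closedBall x ρ) measurableSet_closedBall hi
  have h₁ : |∫ y in (closedBall x ρ)ᶜ, V y * nlapIter m G (y - x)| ≤ C * ∫ y, |V y| := by
    rw [← Real.norm_eq_abs, ← integral_const_mul]
    refine (norm_integral_le_of_norm_le (hV.abs.const_mul C).integrableOn
      (ae_restrict_of_forall_mem measurableSet_closedBall.compl hcompl)).trans ?_
    exact setIntegral_le_integral (hV.abs.const_mul C) (ae_of_all _ fun y => by positivity)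
  have h₂ : |∫ y, F y * G (y - x)| ≤ 2 * ∫ y, |F y| * logKernel (x - y) := by
    rw [← Real.norm_eq_abs, ← integral_const_mul]
    have hint : Integrable fun y => 2 * (|F y| * logKernel (x - y)) :=
      (hF.abs.congr (ae_of_all _ fun y => by
        simp only [abs_mul, abs_of_nonneg (logKernel_nonneg _)])).const_mul 2
    refine norm_integral_le_of_norm_le hint ?_
    have hne : ∀ᵐ y ∂(volume : Measure (EuclideanSpace ℝ (Fin (2 * m)))), y ≠ x := by
      have : Nonempty (Fin (2 * m)) := ⟨⟨0, by omega⟩⟩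
      exact Measure.ae_ne volume x
    filter_upwards [hne] with y hy
    have hsymm : logKernel (x - y) = logKernel (y - x) := by simp only [logKernel, norm_sub_rev]
    rw [norm_mul, Real.norm_eq_abs, Real.norm_eq_abs, hsymm, mul_left_comm]
    refine mul_le_mul_of_nonneg_left ?_ (abs_nonneg _)
    by_cases hs : y - x ∈ tsupport χ
    · rw [hGd]
      simp only [abs_mul, abs_neg]
      have := abs_log_norm_sq_add_le (sub_ne_zero.2 hy) (by simpa using hχs hs)
        (by positivity : 0 < δ ^ 2) (pow_le_one₀ hδ.le hδ1)
      calc |χ (y - x)| * |Real.log (‖y - x‖ ^ 2 + δ ^ 2)|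
          ≤ 1 * |Real.log (‖y - x‖ ^ 2 + δ ^ 2)| :=
            mul_le_mul_of_nonneg_right (hχ1 _) (abs_nonneg _)
        _ ≤ _ := by rwa [one_mul]
    · simp [hGd, image_eq_zero_of_notMem_tsupport hs, logKernel_nonneg]
  rw [setIntegral_congr_fun measurableSet_closedBall hball, integral_const_mul, hVF] at hsplit
  set I := ∫ y in closedBall x ρ, V y * bubble δ (y - x)
  have h₃ : |c * I| ≤ C * (∫ y, |V y|) + 2 * ∫ y, |F y| * logKernel (x - y) := by
    rw [eq_sub_of_add_eq hsplit]
    exact (abs_sub _ _).trans (by linarith)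
  rw [abs_mul, abs_of_pos (by linarith)] at h₃
  exact (le_mul_of_one_le_left (abs_nonneg I) hc1).trans h₃

end Potential

/-- Brézis–Merle type: if `(-Δ)^m v = f ∈ L¹_loc(B_1)` distributionally
in `B_1 ⊂ ℝ^{2m}`, then `e^{p|v|} ∈ L¹_loc(B_1)` for every `p > 1`. -/
theorem stmt_10 (m : ℕ) (hm : 0 < m)
    (f v : EuclideanSpace ℝ (Fin (2*m)) → ℝ)
    (hf : LocallyIntegrableOn f (ball (0 : EuclideanSpace ℝ (Fin (2*m))) 1))
    (hv : LocallyIntegrableOn v (ball (0 : EuclideanSpace ℝ (Fin (2*m))) 1))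
    (heq : ∀ η : EuclideanSpace ℝ (Fin (2*m)) → ℝ, ContDiff ℝ (⊤ : ℕ∞) η →
      HasCompactSupport η → tsupport η ⊆ ball (0 : EuclideanSpace ℝ (Fin (2*m))) 1 →
      ∫ x in ball (0 : EuclideanSpace ℝ (Fin (2*m))) 1, v x * nlapIter m η x
        = ∫ x in ball (0 : EuclideanSpace ℝ (Fin (2*m))) 1, f x * η x) :
    ∀ p : ℝ, 1 < p → ∀ r : ℝ, 0 < r → r < 1 →
      IntegrableOn (fun x => Real.exp (p * |v x|))
        (ball (0 : EuclideanSpace ℝ (Fin (2*m))) r) := by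
  intro p hp r hr hr1
  set ε : ℝ := (1 - r) / 2 with hε
  have hε0 : 0 < ε := by linarith
  set B : Set (EuclideanSpace ℝ (Fin (2*m))) := closedBall 0 (r + ε)
  have hBΩ : B ⊆ ball 0 1 := closedBall_subset_ball (by linarith)
  have hrB : ball 0 r ⊆ B :=
    ball_subset_closedBall.trans (closedBall_subset_closedBall (by linarith))
  have hfB : IntegrableOn f B := hf.integrableOn_compact_subset hBΩ (isCompact_closedBall _ _)
  have hvB : IntegrableOn v B := hv.integrableOn_compact_subset hBΩ (isCompact_closedBall _ _)
  have hF : Integrable (B.indicator f) := hfB.integrable_indicator measurableSet_closedBall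
  have hV : Integrable (B.indicator v) := hvB.integrable_indicator measurableSet_closedBall
  let χ : ContDiffBump (0 : EuclideanSpace ℝ (Fin (2*m))) := ⟨ε / 2, ε, by linarith, by linarith⟩
  have hχρ : ∀ z, ‖z‖ ≤ ε / 4 → χ =ᶠ[nhds z] fun _ => (1 : ℝ) := fun z hz => by
    filter_upwards [isOpen_ball.mem_nhds
      (mem_ball_zero_iff.2 (by linarith : ‖z‖ < ε / 2))] with y hy
    exact χ.one_of_mem_closedBall (ball_subset_closedBall hy)
  obtain ⟨C, hC0, hC⟩ := exists_abs_nlapIter_mul_log_le χ.contDiff χ.hasCompactSupport m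
    (by positivity : 0 < ε / 4)
  refine integrableOn_exp_of_le_logPotential (C := C * ∫ y, |B.indicator v y|)
    (F := fun y => 2 * B.indicator f y)
    (κ := volume.real (ball (0 : EuclideanSpace ℝ (Fin (2*m))) 1) / 2 ^ (2*m))
    (by omega) measurableSet_ball measure_ball_lt_top.ne
    (hvB.mono_set hrB).aestronglyMeasurable (hF.const_mul 2)
    (div_pos volume_real_unitBall_pos (by positivity)) ?_ (by linarith)
  filter_upwards [ae_abs_le_of_abs_setIntegral_mul_bubble_le (by omega)
    (by positivity : 0 < ε / 4) hV.locallyIntegrable] with x hx hxr hint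
  rw [← Set.indicator_of_mem (hrB hxr) v]
  refine hx _ fun k => ?_
  have hδ : 0 < ε / 4 / 2 ^ k := by positivity
  have hδ1 : ε / 4 / 2 ^ k ≤ 1 :=
    (div_le_self (by positivity) (one_le_pow₀ one_le_two)).trans (by linarith)
  have hxB : closedBall x ε ⊆ B := closedBall_subset_closedBall' (by
    have := mem_ball.1 hxr
    linarith)
  have hχs : tsupport χ ⊆ closedBall (0 : EuclideanSpace ℝ (Fin (2*m))) ε := χ.tsupport_eq.subset
  have hVF := integral_indicator_mul_nlapIter_sub measurableSet_ball heq
    (G := fun y => χ y * -Real.log (‖y‖ ^ 2 + (ε / 4 / 2 ^ k) ^ 2))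
    (χ.contDiff.mul (((contDiff_norm_sq ℝ).add contDiff_const).log fun y => by positivity).neg)
    ((tsupport_mul_subset_left).trans hχs) hxB hBΩ
  have hint' : Integrable fun y => B.indicator f y * logKernel (x - y) :=
    (hint.const_mul (1 / 2)).congr (Filter.Eventually.of_forall fun y => by ring)
  refine (abs_setIntegral_mul_bubble_le_logPotential hm hδ hδ1 χ.contDiff
    (hχs.trans (closedBall_subset_closedBall (by linarith)))
    (fun z => by rw [abs_of_nonneg χ.nonneg]; exact χ.le_one) hχρ hV
    (fun z => hC _ (by positivity) (pow_le_one₀ hδ.le hδ1) z) hC0 hVF hint').trans (le_of_eq ?_)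
  congr 1
  rw [← integral_const_mul]
  refine integral_congr_ae (Filter.Eventually.of_forall fun y => ?_)
  simp [abs_mul, mul_assoc]

end
end

section
/- Let n ≥ 2 be an integer, c > 0 a constant, r ∈ (0,1), and let f ∈ L¹(B_r) with ‖f‖_1 := ∫_{B_r} |f| dx > 0, where B_r ⊂ ℝ^n is the ball of radius r centered at the origin. Define N(x) = c ∫_{B_r} ln(5/|x−y|) |f(y)| dy. Then for every k with 0 < k < n/c, one has ∫_{B_r} e^{k N(x)/‖f‖_1} dx ≤ ∫_{B_r} (5/|x|)^{kc} dx = s_n 5^{kc} r^{n−kc}/(n − kc), where s_n is the surface area of the unit sphere in ℝ^n. In particular this integral is finite. -/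
open MeasureTheory Metric Real Set
open scoped ENNReal NNReal

noncomputable section

/-- Jensen's inequality for `exp`; the Bochner integral on the left may be the junk value `0`. -/
theorem ofReal_exp_integral_le_lintegral {α : Type*} [MeasurableSpace α] {μ : Measure α}
    [IsProbabilityMeasure μ] {g : α → ℝ} (hg : AEStronglyMeasurable g μ) (hg0 : 0 ≤ᵐ[μ] g) :
    ENNReal.ofReal (Real.exp (∫ y, g y ∂μ)) ≤ ∫⁻ y, ENNReal.ofReal (Real.exp (g y)) ∂μ := by
  by_cases hgi : Integrable g μ
  · by_cases hei : Integrable (fun y => Real.exp (g y)) μ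
    · rw [← ofReal_integral_eq_lintegral_ofReal hei (.of_forall fun y => (Real.exp_pos _).le)]
      exact ENNReal.ofReal_le_ofReal (convexOn_exp.map_integral_le Real.continuous_exp.continuousOn
        isClosed_univ (by simp) hgi hei)
    · have hem : AEStronglyMeasurable (fun y => Real.exp (g y)) μ :=
        Real.continuous_exp.comp_aestronglyMeasurable hg
      have htop : ∫⁻ y, ENNReal.ofReal (Real.exp (g y)) ∂μ = ∞ := by
        by_contra h
        exact hei ((lintegral_ofReal_ne_top_iff_integrable hem
          (.of_forall fun y => (Real.exp_pos _).le)).1 h)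
      simp [htop]
  · rw [integral_undef hgi]
    calc ENNReal.ofReal (Real.exp 0) = ∫⁻ _, 1 ∂μ := by simp
      _ ≤ _ := by
        refine lintegral_mono_ae ?_
        filter_upwards [hg0] with y hy
        rw [ENNReal.one_le_ofReal]
        exact Real.one_le_exp hy

/-- A function that is larger on `B` than off `B` has, among sets with the measure of `B`,
its largest integral over `B`. -/
theorem setLIntegral_le_of_measure_eq {α : Type*} [MeasurableSpace α] {μ : Measure α}
    {A B : Set α} (hA : MeasurableSet A) (hB : MeasurableSet B) (hAB : μ A = μ B)
    (hfin : μ B ≠ ∞) {h : α → ℝ≥0∞} {t : ℝ≥0∞} (hle : ∀ x, x ∉ B → h x ≤ t)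
    (hge : ∀ᵐ x ∂μ, x ∈ B → t ≤ h x) :
    ∫⁻ x in A, h x ∂μ ≤ ∫⁻ x in B, h x ∂μ := by
  have hmeas : μ (A \ B) = μ (B \ A) :=
    measure_sdiff_symm hA.nullMeasurableSet hB.nullMeasurableSet hAB
      (measure_ne_top_of_subset inter_subset_right hfin)
  rw [← lintegral_inter_add_sdiff h A hB, ← lintegral_inter_add_sdiff h B hA, inter_comm B A]
  refine add_le_add_right ?_ _
  calc ∫⁻ x in A \ B, h x ∂μ ≤ ∫⁻ _ in A \ B, t ∂μ :=
        setLIntegral_mono' (hA.diff hB) fun x hx => hle x hx.2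
    _ = ∫⁻ _ in B \ A, t ∂μ := by simp [hmeas]
    _ ≤ ∫⁻ x in B \ A, h x ∂μ := by
        refine setLIntegral_mono_ae' (hB.diff hA) ?_
        filter_upwards [hge] with x hx hxB using hx hxB.1

theorem measurable_ofReal_div_norm_rpow {E : Type*} [NormedAddCommGroup E] [MeasurableSpace E]
    [OpensMeasurableSpace E] (a p : ℝ) :
    Measurable fun x : E => ENNReal.ofReal ((a / ‖x‖) ^ p) :=
  ((measurable_const.div measurable_norm).pow_const p).ennreal_ofReal

/-- Among all balls of radius `r`, the one centered at the origin maximizes the integral of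
`(a / ‖x‖) ^ p`. -/
theorem setLIntegral_ball_div_norm_sub_rpow_le {E : Type*} [NormedAddCommGroup E]
    [NormedSpace ℝ E] [FiniteDimensional ℝ E] [Nontrivial E] [MeasurableSpace E] [BorelSpace E]
    (μ : Measure E) [μ.IsAddHaarMeasure] {a p r : ℝ} (ha : 0 ≤ a) (hp : 0 ≤ p) (hr : 0 < r)
    (y : E) :
    ∫⁻ x in ball (0 : E) r, ENNReal.ofReal ((a / ‖x - y‖) ^ p) ∂μ
      ≤ ∫⁻ x in ball (0 : E) r, ENNReal.ofReal ((a / ‖x‖) ^ p) ∂μ := by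
  have hshift : ∫⁻ x in ball (0 : E) r, ENNReal.ofReal ((a / ‖x - y‖) ^ p) ∂μ
      = ∫⁻ x in ball (-y) r, ENNReal.ofReal ((a / ‖x‖) ^ p) ∂μ := by
    have hpre : (fun x => x - y) ⁻¹' ball (-y) r = ball (0 : E) r := by
      ext x; simp [dist_eq_norm]
    rw [← hpre]
    exact (measurePreserving_sub_right μ y).setLIntegral_comp_preimage measurableSet_ball
      (measurable_ofReal_div_norm_rpow a p)
  rw [hshift]
  refine setLIntegral_le_of_measure_eq (t := ENNReal.ofReal ((a / r) ^ p)) measurableSet_ball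
    measurableSet_ball (by rw [Measure.addHaar_ball_center]) measure_ball_lt_top.ne ?_ ?_
  · intro x hx
    rw [mem_ball_zero_iff, not_lt] at hx
    gcongr
  · filter_upwards [Measure.ae_ne μ (0 : E)] with x hx0 hx
    have : 0 < ‖x‖ := norm_pos_iff.2 hx0
    rw [mem_ball_zero_iff] at hx
    gcongr

theorem setLIntegral_ball_div_norm_rpow {E : Type*} [NormedAddCommGroup E]
    [NormedSpace ℝ E] [FiniteDimensional ℝ E] [Nontrivial E] [MeasurableSpace E] [BorelSpace E]
    (μ : Measure E) [μ.IsAddHaarMeasure] {a p r : ℝ} (ha : 0 ≤ a) (hr : 0 ≤ r)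
    (hp : p < Module.finrank ℝ E) :
    ∫⁻ x in ball (0 : E) r, ENNReal.ofReal ((a / ‖x‖) ^ p) ∂μ
      = ENNReal.ofReal ((Module.finrank ℝ E * (μ (ball (0 : E) 1)).toReal) * a ^ p *
          r ^ ((Module.finrank ℝ E : ℝ) - p) / (Module.finrank ℝ E - p)) := by
  set d := Module.finrank ℝ E with hd
  have hd1 : 1 ≤ d := Module.finrank_pos
  have hrad : EqOn (fun t : ℝ => t ^ (d - 1) • (a / t) ^ p)
      (fun t => a ^ p * t ^ ((d : ℝ) - 1 - p)) (Ioo 0 r) := by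
    intro t ht
    have ht0 : 0 < t := ht.1
    simp only [smul_eq_mul]
    rw [Real.div_rpow ha ht0.le, Real.rpow_sub ht0, ← Nat.cast_pred hd1, Real.rpow_natCast]
    ring
  have hexp : -1 < (d : ℝ) - 1 - p := by linarith
  have hintegrable : IntegrableOn (fun x : E => (a / ‖x‖) ^ p) (ball 0 r) μ := by
    refine (integrableOn_fun_norm_addHaar μ (f := fun t => (a / t) ^ p)).2 ?_
    rw [integrableOn_congr_fun hrad measurableSet_Ioo]
    refine Integrable.const_mul ?_ _
    exact (intervalIntegrable_iff_integrableOn_Ioo_of_le hr).1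
      (intervalIntegral.intervalIntegrable_rpow' hexp)
  rw [← ofReal_integral_eq_lintegral_ofReal hintegrable (.of_forall fun x => by positivity)]
  congr 1
  have hind : ∫ x in ball (0 : E) r, (a / ‖x‖) ^ p ∂μ
      = ∫ x : E, (Iio r).indicator (fun t => (a / t) ^ p) ‖x‖ ∂μ := by
    rw [← integral_indicator measurableSet_ball]
    congr 1 with x
    simp [indicator]
  have hradint : ∫ t in Ioi (0 : ℝ), t ^ (d - 1) • (Iio r).indicator (fun t => (a / t) ^ p) t
      = a ^ p * (r ^ ((d : ℝ) - p) / (d - p)) := by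
    have hsmul : (fun t : ℝ => t ^ (d - 1) • (Iio r).indicator (fun t => (a / t) ^ p) t)
        = (Iio r).indicator fun t => t ^ (d - 1) • (a / t) ^ p := by
      ext t
      by_cases ht : t < r <;> simp [ht]
    rw [hsmul, setIntegral_indicator measurableSet_Iio, Ioi_inter_Iio,
      setIntegral_congr_fun measurableSet_Ioo hrad, integral_const_mul,
      ← integral_Ioc_eq_integral_Ioo, ← intervalIntegral.integral_of_le hr,
      integral_rpow (.inl hexp)]
    have he : (d : ℝ) - 1 - p + 1 = d - p := by ring
    rw [he, Real.zero_rpow (by linarith), sub_zero]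
  rw [hind, integral_fun_norm_addHaar, ← hd, hradint, nsmul_eq_mul, smul_eq_mul, measureReal_def]
  ring

/-- Jensen-inequality bound for the exponential of the logarithmic
potential `N(x) = c ∫_{B_r} ln(5/|x-y|)|f(y)| dy`. -/
theorem stmt_11 (n : ℕ) (hn : 2 ≤ n) (c r : ℝ) (hc : 0 < c) (hr0 : 0 < r) (hr1 : r < 1)
    (f : EuclideanSpace ℝ (Fin n) → ℝ) (hf : Measurable f)
    (hfint : IntegrableOn f (ball (0 : EuclideanSpace ℝ (Fin n)) r))
    (hfpos : 0 < ∫ y in ball (0 : EuclideanSpace ℝ (Fin n)) r, |f y|)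
    (k : ℝ) (hk0 : 0 < k) (hkn : k < n / c) :
    (∫⁻ x in ball (0 : EuclideanSpace ℝ (Fin n)) r,
        ENNReal.ofReal (Real.exp (k *
          (c * ∫ y in ball (0 : EuclideanSpace ℝ (Fin n)) r, Real.log (5 / ‖x - y‖) * |f y|) /
          (∫ y in ball (0 : EuclideanSpace ℝ (Fin n)) r, |f y|))))
      ≤ ∫⁻ x in ball (0 : EuclideanSpace ℝ (Fin n)) r, ENNReal.ofReal ((5 / ‖x‖) ^ (k * c)) ∧
    ∫⁻ x in ball (0 : EuclideanSpace ℝ (Fin n)) r, ENNReal.ofReal ((5 / ‖x‖) ^ (k * c))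
      = ENNReal.ofReal
          (((n : ℝ) * (volume (ball (0 : EuclideanSpace ℝ (Fin n)) 1)).toReal) *
            5 ^ (k * c) * r ^ ((n : ℝ) - k * c) / ((n : ℝ) - k * c)) := by
  have hkc : 0 < k * c := mul_pos hk0 hc
  have hkcn : k * c < n := (lt_div_iff₀ hc).1 hkn
  have : Nontrivial (EuclideanSpace ℝ (Fin n)) :=
    Module.nontrivial_of_finrank_pos (R := ℝ) (by simp; omega)
  refine ⟨?_, by
    simpa using setLIntegral_ball_div_norm_rpow
      (volume : Measure (EuclideanSpace ℝ (Fin n))) (a := 5) (by norm_num) hr0.le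
      (by simpa using hkcn)⟩
  set B := ball (0 : EuclideanSpace ℝ (Fin n)) r
  set F := ∫ y in B, |f y|
  have hwm : Measurable fun y => ENNReal.ofReal (|f y| / F) :=
    (hf.abs.div_const F).ennreal_ofReal
  set μ := (volume.restrict B).withDensity fun y => ENNReal.ofReal (|f y| / F) with hμ
  have hprob : IsProbabilityMeasure μ := by
    refine ⟨?_⟩
    rw [hμ, withDensity_apply _ .univ, Measure.restrict_univ,
      ← ofReal_integral_eq_lintegral_ofReal (hfint.abs.div_const F)
      (.of_forall fun y => by positivity), integral_div, div_self hfpos.ne', ENNReal.ofReal_one]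
  have hac : μ ≪ volume.restrict B := withDensity_absolutelyContinuous _ _
  have hpoint : ∀ x ∈ B, ENNReal.ofReal (Real.exp (k *
      (c * ∫ y in B, Real.log (5 / ‖x - y‖) * |f y|) / F))
        ≤ ∫⁻ y, ENNReal.ofReal ((5 / ‖x - y‖) ^ (k * c)) ∂μ := by
    intro x hx
    have hnear : ∀ᵐ y ∂μ, 1 ≤ 5 / ‖x - y‖ := by
      refine hac.ae_le ?_
      filter_upwards [ae_restrict_mem measurableSet_ball,
        ae_restrict_of_ae (Measure.ae_ne volume x)] with y hy hyx
      have hpos : 0 < ‖x - y‖ := norm_pos_iff.2 (sub_ne_zero.2 hyx.symm)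
      rw [mem_ball_zero_iff] at hx hy
      rw [one_le_div hpos]
      linarith [norm_sub_le x y]
    have hexponent : k * (c * ∫ y in B, Real.log (5 / ‖x - y‖) * |f y|) / F
        = ∫ y, Real.log (5 / ‖x - y‖) * (k * c) ∂μ := by
      rw [hμ, integral_withDensity_eq_integral_toReal_smul₀ hwm.aemeasurable
        (.of_forall fun _ => ENNReal.ofReal_lt_top), ← mul_assoc, mul_div_right_comm,
        ← integral_const_mul]
      congr 1 with y
      rw [ENNReal.toReal_ofReal (by positivity), smul_eq_mul]
      ring
    rw [hexponent]
    have hlog : Measurable fun y => Real.log (5 / ‖x - y‖) * (k * c) :=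
      (measurable_const.div (measurable_const.sub measurable_id).norm).log.mul_const _
    refine (ofReal_exp_integral_le_lintegral hlog.aestronglyMeasurable ?_).trans_eq
      (lintegral_congr_ae ?_)
    · filter_upwards [hnear] with y hy
      exact mul_nonneg (Real.log_nonneg hy) hkc.le
    · filter_upwards [hnear] with y hy
      rw [Real.rpow_def_of_pos (by linarith)]
  calc _ ≤ ∫⁻ x in B, (∫⁻ y, ENNReal.ofReal ((5 / ‖x - y‖) ^ (k * c)) ∂μ) :=
        setLIntegral_mono' measurableSet_ball hpoint
    _ = ∫⁻ y, (∫⁻ x in B, ENNReal.ofReal ((5 / ‖x - y‖) ^ (k * c))) ∂μ :=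
        lintegral_lintegral_swap ((measurable_ofReal_div_norm_rpow 5 (k * c)).comp
          (measurable_fst.sub measurable_snd)).aemeasurable
    _ ≤ ∫⁻ _, (∫⁻ x in B, ENNReal.ofReal ((5 / ‖x‖) ^ (k * c))) ∂μ :=
        lintegral_mono fun y =>
          setLIntegral_ball_div_norm_sub_rpow_le volume (by norm_num) hkc.le hr0 y
    _ = _ := by simp

end
end

section
/- Let n = 2m ≥ 4 be an even integer and let φ(x) = c_m ln(5/|x|) be the fundamental solution of (−Δ)^m in ℝ^n, c_m > 0. Suppose real constants a_β for multi-indices β with 2 ≤ |β| ≤ 2m−1 satisfy ∫_{B_r} |Σ_{2 ≤ |β| ≤ 2m−1} a_β D^β φ(x)| dx = o(r^{n−2}) as r → 0. Then for each j with 2 ≤ j ≤ 2m−1, the function Σ_{|β| = j} a_β D^β φ is identically zero on ℝ^n \ {0}. -/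
open MeasureTheory Metric Real Set
open scoped ENNReal NNReal

noncomputable section

/-- `f` is smooth off the origin and homogeneous there of degree `-j`, up to an additive constant
depending on the scale when `j = 0`. -/
def IsNegHomogeneous {n : ℕ} (j : ℕ) (f : EuclideanSpace ℝ (Fin n) → ℝ) : Prop :=
  ContDiffOn ℝ ((⊤ : ℕ∞) : WithTop ℕ∞) f {0}ᶜ ∧
    ∀ r : ℝ, 0 < r → ∃ C : ℝ, (j ≠ 0 → C = 0) ∧ ∀ x, x ≠ 0 → f (r • x) = (r ^ j)⁻¹ * f x + C

namespace IsNegHomogeneous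

variable {n : ℕ} {j : ℕ} {f : EuclideanSpace ℝ (Fin n) → ℝ}

theorem pderiv1 (hf : IsNegHomogeneous j f) (i : Fin n) :
    IsNegHomogeneous (j + 1) (pderiv1 i f) := by
  obtain ⟨hs, hh⟩ := hf
  refine ⟨?_, fun r hr => ⟨0, fun _ => rfl, fun x hx => ?_⟩⟩
  · exact (hs.fderiv_of_isOpen isOpen_compl_singleton (by simp)).clm_apply contDiffOn_const
  · obtain ⟨C, -, hC⟩ := hh r hr
    have hd : DifferentiableAt ℝ f x :=
      (hs.contDiffAt (isOpen_compl_singleton.mem_nhds hx)).differentiableAt (by simp)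
    have heq : (fun y => f (r • y)) =ᶠ[nhds x] fun y => (r ^ j)⁻¹ * f y + C :=
      Filter.eventually_of_mem (isOpen_compl_singleton.mem_nhds hx) hC
    have h := heq.fderiv_eq (𝕜 := ℝ)
    rw [fderiv_comp_smul, fderiv_add_const, fderiv_const_mul hd] at h
    have h' := DFunLike.congr_fun h (EuclideanSpace.single i 1)
    simp only [smul_apply, smul_eq_mul] at h'
    simp only [_root_.pderiv1, add_zero]
    rw [pow_succ, mul_inv, mul_right_comm, ← h']
    field_simp

theorem iterate_pderiv1 (hf : IsNegHomogeneous j f) (i : Fin n) (k : ℕ) :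
    IsNegHomogeneous (j + k) ((_root_.pderiv1 i)^[k] f) := by
  induction k with
  | zero => exact hf
  | succ k ih =>
    rw [Function.iterate_succ_apply', ← add_assoc]
    exact ih.pderiv1 i

theorem foldr_pderiv1 (β : Fin n → ℕ) (l : List (Fin n)) :
    ∀ {j : ℕ} {f : EuclideanSpace ℝ (Fin n) → ℝ}, IsNegHomogeneous j f →
    IsNegHomogeneous (j + (l.map β).sum)
      ((l.foldr (fun i F => F ∘ (_root_.pderiv1 i)^[β i]) id) f) := by
  induction l with
  | nil => intro j f hf; simpa using hf
  | cons i l ih =>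
    intro j f hf
    have := ih (hf.iterate_pderiv1 i (β i))
    simpa [add_assoc] using this

theorem mderiv (hf : IsNegHomogeneous j f) (β : Fin n → ℕ) :
    IsNegHomogeneous (j + ∑ i, β i) (mderiv β f) := by
  have h := foldr_pderiv1 β (List.finRange n) hf
  rwa [← List.ofFn_eq_map, List.sum_ofFn] at h

theorem fundSol (m : ℕ) (c : ℝ) : IsNegHomogeneous 0 (fundSol m (2 * m) c) := by
  have hφ : _root_.fundSol m (2 * m) c = fun x => c * Real.log (5 / ‖x‖) := by
    funext x; simp [_root_.fundSol]
  rw [hφ]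
  refine ⟨fun x hx => ?_, fun r hr => ⟨-(c * Real.log r), by simp, fun x hx => ?_⟩⟩
  · have hx' : ‖x‖ ≠ 0 := norm_ne_zero_iff.mpr hx
    exact (contDiffAt_const.mul ((contDiffAt_const.div (contDiffAt_norm ℝ hx) hx').log
      (div_ne_zero (by norm_num) hx'))).contDiffWithinAt
  · have hx' : ‖x‖ ≠ 0 := norm_ne_zero_iff.mpr hx
    beta_reduce
    rw [norm_smul, Real.norm_of_nonneg hr.le, Real.log_div (by norm_num) (by positivity),
      Real.log_div (by norm_num) hx', Real.log_mul hr.ne' hx']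
    ring

end IsNegHomogeneous

/-- Change of variables under dilation for integrals over punctured balls. -/
theorem setLIntegral_puncturedBall_smul {n : ℕ} {F : EuclideanSpace ℝ (Fin n) → ℝ≥0∞}
    (hF : Measurable F) {r : ℝ} (hr : 0 < r) :
    ∫⁻ x in ball (0 : EuclideanSpace ℝ (Fin n)) 1 \ {0}, F (r • x) =
      ENNReal.ofReal ((r ^ n)⁻¹) * ∫⁻ x in ball (0 : EuclideanSpace ℝ (Fin n)) r \ {0}, F x := by
  have hpre : (fun x : EuclideanSpace ℝ (Fin n) => r • x) ⁻¹' (ball 0 r \ {0}) =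
      ball 0 1 \ {0} := by
    ext x
    simp [norm_smul, abs_of_pos hr, hr.ne', hr]
  have hmap := Measure.map_addHaar_smul (volume : Measure (EuclideanSpace ℝ (Fin n))) hr.ne'
  rw [← hpre, ← setLIntegral_map (measurableSet_ball.diff (measurableSet_singleton 0)) hF
    (measurable_const_smul r), hmap, Measure.restrict_smul, lintegral_smul_measure]
  simp [abs_of_pos hr]

/-- A polynomial whose absolute values, along reals tending to infinity, have vanishing lower
limit is zero. -/
theorem Polynomial.eq_zero_of_liminf_ofReal_abs_eval (P : Polynomial ℝ) {t : ℕ → ℝ}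
    (ht : Filter.Tendsto t Filter.atTop Filter.atTop)
    (h : Filter.liminf (fun k => ENNReal.ofReal |P.eval (t k)|) Filter.atTop = 0) : P = 0 := by
  by_cases hP : 0 < P.degree
  · have := (ENNReal.tendsto_ofReal_atTop.comp ((P.abs_tendsto_atTop hP).comp ht)).liminf_eq
    simp only [Function.comp_def] at this
    rw [this] at h
    exact absurd h ENNReal.top_ne_zero
  · rw [Polynomial.eq_C_of_degree_le_zero (not_lt.mp hP)] at h ⊢
    simpa using h

/-- Functions homogeneous of degrees `-2, …, -N` whose sum has `L¹` norm `o(r ^ (n - 2))` on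
small balls vanish off the origin. -/
theorem eq_zero_of_lintegral_sum_isLittleO {n N : ℕ} (hn : 2 ≤ n)
    (g : ℕ → EuclideanSpace ℝ (Fin n) → ℝ) (hg : ∀ j, ContinuousOn (g j) {0}ᶜ)
    (hhom : ∀ j ∈ Finset.Icc 2 N, ∀ r : ℝ, 0 < r → ∀ x, x ≠ 0 →
      g j (r • x) = (r ^ j)⁻¹ * g j x)
    (hlittleo : ∀ ε > (0 : ℝ), ∃ δ > (0 : ℝ), ∀ r : ℝ, 0 < r → r < δ →
      ∫⁻ x in ball (0 : EuclideanSpace ℝ (Fin n)) r,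
        ENNReal.ofReal |∑ j ∈ Finset.Icc 2 N, g j x| ≤ ENNReal.ofReal (ε * r ^ (n - 2)))
    {j : ℕ} (hj : j ∈ Finset.Icc 2 N) {x : EuclideanSpace ℝ (Fin n)} (hx : x ≠ 0) :
    g j x = 0 := by
  have hmeas : ∀ j, Measurable (g j) := fun j =>
    measurable_of_continuousOn_compl_singleton 0 (hg j)
  set S : Set (EuclideanSpace ℝ (Fin n)) := ball 0 1 \ {0}
  have hSo : IsOpen S := isOpen_ball.sdiff isClosed_singleton
  let P : EuclideanSpace ℝ (Fin n) → Polynomial ℝ := fun x =>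
    ∑ j ∈ Finset.Icc 2 N, Polynomial.monomial (j - 2) (g j x)
  have heval : ∀ x t, (P x).eval t = ∑ j ∈ Finset.Icc 2 N, g j x * t ^ (j - 2) := by
    intro x t
    simp [P, Polynomial.eval_finsetSum]
  have hscale : ∀ r : ℝ, 0 < r → ∀ x ∈ S,
      |(P x).eval r⁻¹| = r ^ 2 * |∑ j ∈ Finset.Icc 2 N, g j (r • x)| := by
    intro r hr x hx
    conv_rhs => rw [← abs_of_nonneg (sq_nonneg r), ← abs_mul, Finset.mul_sum]
    rw [heval]
    congr 1
    refine Finset.sum_congr rfl fun j hj => ?_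
    obtain ⟨k, rfl⟩ := Nat.exists_eq_add_of_le (Finset.mem_Icc.mp hj).1
    rw [hhom _ hj r hr x hx.2, Nat.add_sub_cancel_left, pow_add, inv_pow]
    field_simp
  have hbound : ∀ ε > (0 : ℝ), ∃ δ > (0 : ℝ), ∀ r : ℝ, 0 < r → r < δ →
      ∫⁻ x in S, ENNReal.ofReal |(P x).eval r⁻¹| ≤ ENNReal.ofReal ε := by
    intro ε hε
    obtain ⟨δ, hδ, h⟩ := hlittleo ε hε
    refine ⟨δ, hδ, fun r hr hrδ => ?_⟩
    have hF : Measurable fun x => ENNReal.ofReal |∑ j ∈ Finset.Icc 2 N, g j x| := by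
      simp_rw [← Real.norm_eq_abs]
      exact (Finset.measurable_fun_sum _ fun j _ => hmeas j).norm.ennreal_ofReal
    calc ∫⁻ x in S, ENNReal.ofReal |(P x).eval r⁻¹|
        = ∫⁻ x in S, ENNReal.ofReal (r ^ 2) *
            ENNReal.ofReal |∑ j ∈ Finset.Icc 2 N, g j (r • x)| := by
          refine setLIntegral_congr_fun hSo.measurableSet fun x hx => ?_
          rw [hscale r hr x hx, ENNReal.ofReal_mul (sq_nonneg r)]
      _ = ENNReal.ofReal (r ^ 2) * (ENNReal.ofReal ((r ^ n)⁻¹) *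
            ∫⁻ x in ball (0 : EuclideanSpace ℝ (Fin n)) r \ {0},
              ENNReal.ofReal |∑ j ∈ Finset.Icc 2 N, g j x|) := by
          rw [lintegral_const_mul' _ _ ENNReal.ofReal_ne_top,
            setLIntegral_puncturedBall_smul hF hr]
      _ ≤ ENNReal.ofReal (r ^ 2) * (ENNReal.ofReal ((r ^ n)⁻¹) *
            ENNReal.ofReal (ε * r ^ (n - 2))) := by
          gcongr
          exact (lintegral_mono_set sdiff_subset).trans (h r hr hrδ)
      _ = ENNReal.ofReal ε := by
          rw [← ENNReal.ofReal_mul (by positivity), ← ENNReal.ofReal_mul (by positivity)]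
          congr 1
          obtain ⟨k, rfl⟩ := Nat.exists_eq_add_of_le hn
          rw [Nat.add_sub_cancel_left, pow_add]
          field_simp
  let t : ℕ → ℝ := fun k => (k : ℝ) + 1
  have ht : Filter.Tendsto t Filter.atTop Filter.atTop :=
    Filter.tendsto_atTop_add_const_right _ _ tendsto_natCast_atTop_atTop
  let F : ℕ → EuclideanSpace ℝ (Fin n) → ℝ≥0∞ := fun k x => ENNReal.ofReal |(P x).eval (t k)|
  have hFm : ∀ k, Measurable (F k) := by
    intro k
    simp only [F, heval, ← Real.norm_eq_abs]
    exact (Finset.measurable_fun_sum _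
      fun j _ => (hmeas j).mul_const _).norm.ennreal_ofReal
  have hlim : Filter.Tendsto (fun k => ∫⁻ x in S, F k x) Filter.atTop (nhds 0) := by
    rw [ENNReal.tendsto_nhds_zero]
    intro ε hε
    obtain ⟨ε', -, hε', hle⟩ := ENNReal.lt_iff_exists_real_btwn.mp hε
    obtain ⟨δ, hδ, h⟩ := hbound ε' (ENNReal.ofReal_pos.mp hε')
    filter_upwards [ht.eventually_gt_atTop δ⁻¹] with k hk
    have hpos : 0 < t k := (inv_pos.mpr hδ).trans hk
    have := h (t k)⁻¹ (inv_pos.mpr hpos) (inv_lt_of_inv_lt₀ hδ hk)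
    rw [inv_inv] at this
    exact this.trans hle.le
  have hae : ∀ᵐ x ∂(volume.restrict S), Filter.liminf (fun k => F k x) Filter.atTop = 0 := by
    have h0 : ∫⁻ x in S, Filter.liminf (fun k => F k x) Filter.atTop = 0 :=
      le_antisymm ((lintegral_liminf_le hFm).trans hlim.liminf_eq.le) zero_le
    exact (lintegral_eq_zero_iff (Measurable.liminf hFm)).mp h0
  have hgae : g j =ᵐ[volume.restrict S] fun _ => 0 := by
    filter_upwards [hae] with x hx
    have hP := (P x).eq_zero_of_liminf_ofReal_abs_eval ht hx
    have hc := congrArg (fun p => p.coeff (j - 2)) hP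
    simp only [P, Polynomial.finsetSum_coeff, Polynomial.coeff_monomial,
      Polynomial.coeff_zero] at hc
    rw [Finset.sum_eq_single j] at hc
    · simpa using hc
    · intro i hi hij
      rw [Finset.mem_Icc] at hi hj
      exact if_neg (by omega)
    · exact fun h => absurd hj h
  have hzero : EqOn (g j) (fun _ => 0) S := Measure.eqOn_open_of_ae_eq hgae hSo
    ((hg j).mono fun x hx => hx.2) continuousOn_const
  have hpos : 0 < (2 * ‖x‖)⁻¹ := by positivity
  have hmem : (2 * ‖x‖)⁻¹ • x ∈ S := by
    refine ⟨?_, smul_ne_zero hpos.ne' hx⟩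
    have hx' : ‖x‖ ≠ 0 := norm_ne_zero_iff.mpr hx
    rw [mem_ball_zero_iff, norm_smul, Real.norm_of_nonneg hpos.le, mul_inv, mul_assoc,
      inv_mul_cancel₀ hx']
    norm_num
  have h := hzero hmem
  rw [hhom j hj _ hpos x hx] at h
  exact (mul_eq_zero.mp h).resolve_left (by positivity)

/-- if `∫_{B_r} |∑_{2 ≤ |β| ≤ 2m-1} a_β D^β φ| dx = o(r^{n-2})` as `r → 0`
(with `φ = c_m ln(5/|x|)`, `n = 2m`), then each homogeneous layer
`∑_{|β| = j} a_β D^β φ`, `2 ≤ j ≤ 2m-1`, vanishes identically off the origin. -/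
theorem stmt_15 (m : ℕ) (hm : 2 ≤ m) (cm : ℝ) (hc : 0 < cm)
    (a : (Fin (2*m) → ℕ) → ℝ)
    (hlittleo : ∀ ε > (0 : ℝ), ∃ δ > (0 : ℝ), ∀ r : ℝ, 0 < r → r < δ →
      ∫⁻ x in ball (0 : EuclideanSpace ℝ (Fin (2*m))) r,
          ENNReal.ofReal
            |∑ β ∈ (degLE (2*m) (2*m - 1)).filter (fun β => 2 ≤ ∑ i, β i),
              a β * mderiv β (fundSol m (2*m) cm) x|
        ≤ ENNReal.ofReal (ε * r ^ (2*m - 2))) :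
    ∀ j : ℕ, 2 ≤ j → j ≤ 2*m - 1 →
      ∀ x : EuclideanSpace ℝ (Fin (2*m)), x ≠ 0 →
        ∑ β ∈ (degLE (2*m) (2*m - 1)).filter (fun β => ∑ i, β i = j),
          a β * mderiv β (fundSol m (2*m) cm) x = 0 := by
  intro j hj2 hjm x hx
  have hH (β : Fin (2*m) → ℕ) : IsNegHomogeneous (∑ i, β i) (mderiv β (fundSol m (2*m) cm)) := by
    simpa using (IsNegHomogeneous.fundSol m cm).mderiv β
  refine eq_zero_of_lintegral_sum_isLittleO (N := 2*m - 1) (by omega)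
    (fun j x => ∑ β ∈ (degLE (2*m) (2*m - 1)).filter (fun β => ∑ i, β i = j),
      a β * mderiv β (fundSol m (2*m) cm) x) ?_ ?_ ?_ (Finset.mem_Icc.mpr ⟨hj2, hjm⟩) hx
  · exact fun j => continuousOn_finsetSum _ fun β _ => continuousOn_const.mul (hH β).1.continuousOn
  · intro j hj r hr x hx
    rw [Finset.mul_sum]
    refine Finset.sum_congr rfl fun β hβ => ?_
    obtain ⟨C, hC, h⟩ := (hH β).2 r hr
    have hβj := (Finset.mem_filter.mp hβ).2
    have hj' := (Finset.mem_Icc.mp hj).1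
    rw [h x hx, hC (by omega), hβj]
    ring
  · have hsum (x : EuclideanSpace ℝ (Fin (2*m))) :
        ∑ j ∈ Finset.Icc 2 (2*m - 1),
          ∑ β ∈ (degLE (2*m) (2*m - 1)).filter (fun β => ∑ i, β i = j),
            a β * mderiv β (fundSol m (2*m) cm) x =
        ∑ β ∈ (degLE (2*m) (2*m - 1)).filter (fun β => 2 ≤ ∑ i, β i),
          a β * mderiv β (fundSol m (2*m) cm) x := by
      rw [← Finset.sum_fiberwise_of_maps_to (t := Finset.Icc 2 (2*m - 1))
        (g := fun β : Fin (2*m) → ℕ => ∑ i, β i)]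
      · refine Finset.sum_congr rfl fun j hj => ?_
        rw [Finset.filter_filter]
        refine Finset.sum_congr (Finset.filter_congr fun β _ => ?_) fun _ _ => rfl
        have hj' := (Finset.mem_Icc.mp hj).1
        constructor
        · rintro rfl
          exact ⟨hj', rfl⟩
        · exact And.right
      · intro β hβ
        simp only [degLE, Finset.mem_filter] at hβ
        exact Finset.mem_Icc.mpr ⟨hβ.2, hβ.1.2⟩
    simpa only [hsum] using hlittleo

end
end
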